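/- arXiv:2210.15550 — 2 statements merged into one kernel-verified Lean document; each statement's English description precedes it below -/
import Mathlib

section
/- Let η ∈ {0,1}^ℤ be the full-step configuration and ν any Bernoulli product measure on {0,1}^ℤ with ν(η(k)=1) = 0 for k > 0. Then for the symmetric exclusion process and any z ∈ ℝ and t ≥ 0: ∑_{k>z}(E_ν[η_t(k)])² + 𝒞_t(ν,z) ≤ ∑_{k>z}(E_η[η_t(k)])² + 𝒞_t(η,z), where 𝒞_t(μ,z) = -∑_{j≠k, j,k>z} Cov_μ(η_t(j), η_t(k)). -/
open MeasureTheory Filter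
open scoped Topology ENNReal

/-- `n`-fold convolution power of a step distribution `p` on `ℤ`:
the distribution of the discrete-time walk after `n` steps. -/
noncomputable def convPow (p : ℤ → ℝ) : ℕ → ℤ → ℝ
  | 0 => fun x => if x = 0 then 1 else 0
  | n + 1 => fun x => ∑' y : ℤ, convPow p n y * p (x - y)

/-- Distribution at time `t` of the rate-1 continuous-time random walk on `ℤ`
started at `0` with step distribution `p`: `ξ_t = S_{N_t}` with `N` a rate-1
Poisson process independent of the discrete walk `S`. -/
noncomputable def ctPMF (p : ℤ → ℝ) (t : ℝ) (x : ℤ) : ℝ :=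
  ∑' n : ℕ, (Real.exp (-t) * t ^ n / n.factorial) * convPow p n x

/-- `P_0(ξ_t > z)`. -/
noncomputable def ctTailGt (p : ℤ → ℝ) (t z : ℝ) : ℝ :=
  ∑' x : ℤ, if z < (x : ℝ) then ctPMF p t x else 0

/-- `P_0(ξ_t ≥ z)`. -/
noncomputable def ctTailGe (p : ℤ → ℝ) (t z : ℝ) : ℝ :=
  ∑' x : ℤ, if z ≤ (x : ℝ) then ctPMF p t x else 0

/-- One-particle exclusion (= random walk) semigroup applied to a profile `η`:
by duality, `E_η[η_t(k)] = E_k[η(ξ_t)] = ∑_y P₀(ξ_t = y - k) η(y)`. -/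
noncomputable def oneP (p : ℤ → ℝ) (η : ℤ → ℝ) (s : ℝ) (k : ℤ) : ℝ :=
  ∑' y : ℤ, ctPMF p s (y - k) * η y

/-- Generator `𝒱` of two exclusion particles on `ℤ` with symmetric rates `p`. -/
noncomputable def twoGen (p : ℤ → ℝ) (f : ℤ → ℤ → ℝ) (x y : ℤ) : ℝ :=
  (∑' z : ℤ, if z ≠ y then p (z - x) * (f z y - f x y) else 0)
    + ∑' z : ℤ, if z ≠ x then p (z - y) * (f x z - f x y) else 0


/-- The averaging operator of a kernel `q`. -/
noncomputable def kerOp {S : Type*} (q : S → S → ℝ≥0∞) (f : S → ℝ≥0∞) (x : S) : ℝ≥0∞ :=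
  ∑' y, q x y * f y

/-- Poisson weights of parameter `t`. -/
noncomputable def poissonWeight (t : ℝ) (n : ℕ) : ℝ≥0∞ :=
  ENNReal.ofReal (Real.exp (-t) * t ^ n / n.factorial)

/-- The semigroup `exp (t (q - 1))`. -/
noncomputable def kerSemi {S : Type*} (q : S → S → ℝ≥0∞) (t : ℝ) (f : S → ℝ≥0∞) (x : S) : ℝ≥0∞ :=
  ∑' n, poissonWeight t n * (kerOp q)^[n] f x

lemma poissonWeight_ne_top (t : ℝ) (n : ℕ) : poissonWeight t n ≠ ⊤ := ENNReal.ofReal_ne_top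

lemma toReal_poissonWeight {t : ℝ} (ht : 0 ≤ t) (n : ℕ) :
    (poissonWeight t n).toReal = Real.exp (-t) * t ^ n / n.factorial :=
  ENNReal.toReal_ofReal (by positivity)

lemma tsum_poissonWeight_mul_pow {t : ℝ} (ht : 0 ≤ t) {m : ℝ} (hm : 0 ≤ m) :
    ∑' n, poissonWeight t n * ENNReal.ofReal m ^ n
      = ENNReal.ofReal (Real.exp (-t) * Real.exp (t * m)) := by
  have h : ∀ n : ℕ, poissonWeight t n * ENNReal.ofReal m ^ n
      = ENNReal.ofReal (Real.exp (-t) * ((t * m) ^ n / n.factorial)) := by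
    intro n
    rw [poissonWeight, ← ENNReal.ofReal_pow hm, ← ENNReal.ofReal_mul (by positivity)]
    congr 1
    rw [mul_pow]; ring
  simp_rw [h]
  rw [← ENNReal.ofReal_tsum_of_nonneg (fun n => by positivity)
    ((Real.summable_pow_div_factorial _).mul_left _), tsum_mul_left, Real.exp_eq_exp_ℝ,
    NormedSpace.exp_eq_tsum_div]

lemma tsum_poissonWeight {t : ℝ} (ht : 0 ≤ t) : ∑' n, poissonWeight t n = 1 := by
  have := tsum_poissonWeight_mul_pow ht zero_le_one
  simpa [← Real.exp_add] using this

section Kernel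

variable {S : Type*} {q : S → S → ℝ≥0∞}

lemma kerOp_mono {f g : S → ℝ≥0∞} (h : ∀ x, f x ≤ g x) (x : S) : kerOp q f x ≤ kerOp q g x :=
  ENNReal.tsum_le_tsum fun y => by gcongr; exact h y

lemma kerOp_le_one (hq : ∀ x, ∑' y, q x y ≤ 1) {f : S → ℝ≥0∞} (hf : ∀ x, f x ≤ 1) (x : S) :
    kerOp q f x ≤ 1 :=
  (ENNReal.tsum_le_tsum fun y => mul_le_of_le_one_right' (hf y)).trans (hq x)

lemma iterate_kerOp_mono {f g : S → ℝ≥0∞} (h : ∀ x, f x ≤ g x) (n : ℕ) (x : S) :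
    (kerOp q)^[n] f x ≤ (kerOp q)^[n] g x := by
  induction n generalizing f g with
  | zero => exact h x
  | succ n ih => exact ih (kerOp_mono h)

lemma iterate_kerOp_le_one (hq : ∀ x, ∑' y, q x y ≤ 1) {f : S → ℝ≥0∞} (hf : ∀ x, f x ≤ 1)
    (n : ℕ) (x : S) : (kerOp q)^[n] f x ≤ 1 := by
  induction n generalizing f with
  | zero => exact hf x
  | succ n ih => exact ih (kerOp_le_one hq hf)

lemma kerSemi_mono {f g : S → ℝ≥0∞} (h : ∀ x, f x ≤ g x) (t : ℝ) (x : S) :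
    kerSemi q t f x ≤ kerSemi q t g x :=
  ENNReal.tsum_le_tsum fun n => by gcongr; exact iterate_kerOp_mono h n x

lemma kerSemi_le_one (hq : ∀ x, ∑' y, q x y ≤ 1) {f : S → ℝ≥0∞} (hf : ∀ x, f x ≤ 1)
    {t : ℝ} (ht : 0 ≤ t) (x : S) : kerSemi q t f x ≤ 1 :=
  (ENNReal.tsum_le_tsum fun n => mul_le_of_le_one_right'
    (iterate_kerOp_le_one hq hf n x)).trans (tsum_poissonWeight ht).le

lemma kerSemi_ne_top (hq : ∀ x, ∑' y, q x y ≤ 1) {f : S → ℝ≥0∞} (hf : ∀ x, f x ≤ 1)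
    {t : ℝ} (ht : 0 ≤ t) (x : S) : kerSemi q t f x ≠ ⊤ :=
  ((kerSemi_le_one hq hf ht x).trans_lt ENNReal.one_lt_top).ne

lemma kerSemi_zero (f : S → ℝ≥0∞) (x : S) : kerSemi q 0 f x = f x := by
  rw [kerSemi, tsum_eq_single 0]
  · simp [poissonWeight]
  · intro n hn
    simp [poissonWeight, hn]

lemma kerOp_adjoint (hs : ∀ x y, q x y = q y x) (f g : S → ℝ≥0∞) :
    ∑' x, g x * kerOp q f x = ∑' x, kerOp q g x * f x := by
  simp_rw [kerOp, ← ENNReal.tsum_mul_left, ← ENNReal.tsum_mul_right]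
  rw [ENNReal.tsum_comm]
  refine tsum_congr fun y => tsum_congr fun x => ?_
  rw [hs x y]; ring

lemma iterate_kerOp_adjoint (hs : ∀ x y, q x y = q y x) (n : ℕ) (f g : S → ℝ≥0∞) :
    ∑' x, g x * (kerOp q)^[n] f x = ∑' x, (kerOp q)^[n] g x * f x := by
  induction n generalizing f g with
  | zero => rfl
  | succ n ih =>
    rw [Function.iterate_succ_apply, ih, kerOp_adjoint hs, Function.iterate_succ_apply']

lemma kerSemi_adjoint (hs : ∀ x y, q x y = q y x) (t : ℝ) (f g : S → ℝ≥0∞) :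
    ∑' x, g x * kerSemi q t f x = ∑' x, kerSemi q t g x * f x := by
  simp_rw [kerSemi, ← ENNReal.tsum_mul_left, ← ENNReal.tsum_mul_right]
  rw [ENNReal.tsum_comm, ENNReal.tsum_comm (α := S)]
  refine tsum_congr fun n => ?_
  simp_rw [mul_left_comm _ (poissonWeight t n), mul_assoc, ENNReal.tsum_mul_left,
    iterate_kerOp_adjoint hs]

lemma kerOp_kerSemi (t : ℝ) (f : S → ℝ≥0∞) (x : S) :
    kerOp q (kerSemi q t f) x = ∑' n, poissonWeight t n * (kerOp q)^[n + 1] f x := by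
  simp_rw [Function.iterate_succ_apply']
  simp_rw [kerOp, kerSemi, ← ENNReal.tsum_mul_left]
  rw [ENNReal.tsum_comm]
  exact tsum_congr fun n => tsum_congr fun y => mul_left_comm _ _ _

lemma hasDerivAt_tsum_pow_div_factorial {a : ℕ → ℝ} (ha : ∀ n, |a n| ≤ 1) (t : ℝ) :
    HasDerivAt (fun s : ℝ => ∑' n : ℕ, s ^ n / n.factorial * a n)
      (∑' n : ℕ, t ^ n / n.factorial * a (n + 1)) t := by
  have hsum : ∀ s : ℝ, Summable fun n : ℕ => s ^ n / n.factorial * a n := fun s =>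
    Summable.of_norm_bounded (Real.summable_pow_div_factorial |s|) fun n => by
      rw [norm_mul, Real.norm_eq_abs, Real.norm_eq_abs, abs_div, abs_pow, Nat.abs_cast]
      exact mul_le_of_le_one_right (by positivity) (ha n)
  set R := |t| + 1
  have hu : Summable fun n : ℕ => (n : ℝ) * R ^ (n - 1) / n.factorial := by
    rw [← summable_nat_add_iff 1]
    refine (Real.summable_pow_div_factorial R).congr fun n => ?_
    have := Nat.factorial_ne_zero n
    rw [Nat.factorial_succ]
    push_cast
    field_simp
  have key := hasDerivAt_tsum_of_isPreconnected (t := Metric.ball (0 : ℝ) R) (y₀ := t) (y := t)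
    (g := fun (n : ℕ) (s : ℝ) => s ^ n / n.factorial * a n)
    (g' := fun (n : ℕ) (s : ℝ) => n * s ^ (n - 1) / n.factorial * a n)
    hu Metric.isOpen_ball (convex_ball _ _).isPreconnected
    (fun n s _ => ((hasDerivAt_pow n s).div_const _).mul_const _)
    (fun n s hs => by
      rw [mem_ball_zero_iff, Real.norm_eq_abs] at hs
      rw [norm_mul, Real.norm_eq_abs, Real.norm_eq_abs, abs_div, abs_mul, abs_pow, Nat.abs_cast,
        Nat.abs_cast]
      refine (mul_le_of_le_one_right (by positivity) (ha n)).trans ?_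
      gcongr)
    (by simp [R]) (hsum t) (by simp [R])
  refine key.congr_deriv ?_
  rw [tsum_eq_zero_add' (f := fun n : ℕ => (n : ℝ) * t ^ (n - 1) / n.factorial * a n)]
  · simp only [Nat.cast_zero, zero_mul, zero_div, zero_add]
    refine tsum_congr fun n => ?_
    have := Nat.factorial_ne_zero n
    rw [Nat.factorial_succ]
    push_cast
    field_simp
  · refine Summable.of_norm_bounded (Real.summable_pow_div_factorial |t|) fun n => ?_
    have := Nat.factorial_ne_zero n
    have h1 : ((n + 1 : ℕ) : ℝ) * t ^ (n + 1 - 1) / (n + 1).factorial * a (n + 1)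
        = t ^ n / n.factorial * a (n + 1) := by
      rw [Nat.factorial_succ]
      push_cast
      field_simp
    rw [h1, norm_mul, Real.norm_eq_abs, Real.norm_eq_abs, abs_div, abs_pow, Nat.abs_cast]
    exact mul_le_of_le_one_right (by positivity) (ha _)

lemma toReal_kerSemi (hq : ∀ x, ∑' y, q x y ≤ 1) {f : S → ℝ≥0∞} (hf : ∀ x, f x ≤ 1)
    {t : ℝ} (ht : 0 ≤ t) (x : S) :
    (kerSemi q t f x).toReal
      = Real.exp (-t) * ∑' n : ℕ, t ^ n / n.factorial * ((kerOp q)^[n] f x).toReal := by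
  rw [kerSemi, ENNReal.tsum_toReal_eq, ← tsum_mul_left]
  · refine tsum_congr fun n => ?_
    rw [ENNReal.toReal_mul, toReal_poissonWeight ht]; ring
  · exact fun n => ENNReal.mul_ne_top (poissonWeight_ne_top _ _)
      ((iterate_kerOp_le_one hq hf n x).trans_lt ENNReal.one_lt_top).ne

lemma hasDerivWithinAt_kerSemi (hq : ∀ x, ∑' y, q x y ≤ 1) {f : S → ℝ≥0∞} (hf : ∀ x, f x ≤ 1)
    {t : ℝ} (ht : 0 ≤ t) (x : S) :
    HasDerivWithinAt (fun s => (kerSemi q s f x).toReal)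
      ((kerOp q (kerSemi q t f) x).toReal - (kerSemi q t f x).toReal) (Set.Ici 0) t := by
  have ha : ∀ n, |((kerOp q)^[n] f x).toReal| ≤ 1 := fun n => by
    rw [abs_of_nonneg ENNReal.toReal_nonneg]
    exact ENNReal.toReal_mono ENNReal.one_ne_top (iterate_kerOp_le_one hq hf n x)
  have h1 := ((Real.hasDerivAt_exp (-t)).comp t (hasDerivAt_neg t)).mul
    (hasDerivAt_tsum_pow_div_factorial ha t)
  have h2 : (kerOp q (kerSemi q t f) x).toReal
      = Real.exp (-t) * ∑' n : ℕ, t ^ n / n.factorial * ((kerOp q)^[n + 1] f x).toReal := by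
    rw [kerOp_kerSemi]
    exact toReal_kerSemi hq (kerOp_le_one hq hf) ht x
  rw [h2, toReal_kerSemi hq hf ht]
  refine (h1.hasDerivWithinAt.congr_deriv ?_).congr_of_mem
    (fun s hs => toReal_kerSemi hq hf hs x) ht
  simp only [Function.comp_apply]
  ring

end Kernel

/-- Minimum principle for differential inequalities driven by a bounded Markov generator. -/
lemma nonneg_of_generator_bound {S : Type*} {w w' : ℝ → S → ℝ} {r C : ℝ} (hr : 0 ≤ r) (hC : 0 ≤ C)
    (hd : ∀ x, ∀ t, 0 ≤ t → HasDerivWithinAt (fun s => w s x) (w' t x) (Set.Ici 0) t)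
    (hL : ∀ t, 0 ≤ t → ∀ M, 0 ≤ M → (∀ x, -M ≤ w t x) → ∀ x, -(r * (M + w t x)) ≤ w' t x)
    (hb : ∀ t, 0 ≤ t → ∀ x, -C ≤ w t x) (h0 : ∀ x, 0 ≤ w 0 x) {t : ℝ} (ht : 0 ≤ t) (x : S) :
    0 ≤ w t x := by
  have main : ∀ n : ℕ, ∀ s ∈ Set.Icc 0 t, ∀ x,
      -(C * Real.exp (r * t) * (r * s) ^ n / n.factorial) ≤ Real.exp (r * s) * w s x := by
    intro n
    induction n with
    | zero =>
      intro s hs x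
      have h1 := hb s hs.1 x
      have h2 : Real.exp (r * s) ≤ Real.exp (r * t) :=
        Real.exp_le_exp.2 (mul_le_mul_of_nonneg_left hs.2 hr)
      have h3 := Real.exp_pos (r * s)
      simp only [pow_zero, mul_one, Nat.factorial_zero, Nat.cast_one, div_one]
      nlinarith
    | succ n ih =>
      intro s hs x
      have hder : ∀ u ∈ Set.Icc 0 s, HasDerivWithinAt
          (fun u => Real.exp (r * u) * w u x
            + C * Real.exp (r * t) * (r * u) ^ (n + 1) / (n + 1).factorial)
          (Real.exp (r * u) * (r * w u x + w' u x)
            + r * (C * Real.exp (r * t) * (r * u) ^ n / n.factorial)) (Set.Icc 0 s) u := by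
        intro u hu
        have e1 : HasDerivAt (fun u : ℝ => r * u) r u := by
          simpa using (hasDerivAt_id u).const_mul r
        have e2 := (e1.exp.hasDerivWithinAt (s := Set.Icc 0 s)).mul
          ((hd x u hu.1).mono Set.Icc_subset_Ici_self)
        have e3 := (((e1.pow (n + 1)).const_mul (C * Real.exp (r * t))).div_const
          ((n + 1).factorial : ℝ)).hasDerivWithinAt (s := Set.Icc 0 s)
        refine (e2.add e3).congr_deriv ?_
        have := Nat.factorial_ne_zero n
        rw [Nat.factorial_succ]
        push_cast
        field_simp
      have hmono : MonotoneOn (fun u => Real.exp (r * u) * w u x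
            + C * Real.exp (r * t) * (r * u) ^ (n + 1) / (n + 1).factorial) (Set.Icc 0 s) := by
        refine monotoneOn_of_hasDerivWithinAt_nonneg (convex_Icc 0 s)
          (fun u hu => (hder u hu).continuousWithinAt)
          (fun u hu => (hder u (interior_subset hu)).mono interior_subset) ?_
        intro u hu
        have hu := interior_subset hu
        have hE := Real.exp_pos (r * u)
        set K := C * Real.exp (r * t) * (r * u) ^ n / n.factorial with hK
        have hK0 : 0 ≤ K := by have := hu.1; positivity
        have := hL u hu.1 (K / Real.exp (r * u)) (by positivity) (fun y => by
          rw [← neg_div, div_le_iff₀ hE, mul_comm]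
          exact ih u ⟨hu.1, hu.2.trans hs.2⟩ y) x
        have h5 : Real.exp (r * u) * (K / Real.exp (r * u)) = K := by field_simp
        nlinarith [mul_le_mul_of_nonneg_left this hE.le]
      have := hmono ⟨le_rfl, hs.1⟩ ⟨hs.1, le_rfl⟩ hs.1
      have h0x := h0 x
      simp only [mul_zero, Real.exp_zero, one_mul, ne_eq, Nat.succ_ne_zero, not_false_eq_true,
        zero_pow, zero_div, add_zero] at this
      linarith
  have lim : Tendsto (fun n : ℕ => -(C * Real.exp (r * t) * (r * t) ^ n / n.factorial)) atTop
      (𝓝 0) := by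
    have := ((FloorSemiring.tendsto_pow_div_factorial_atTop (r * t)).const_mul
      (C * Real.exp (r * t))).neg
    simpa [mul_div_assoc] using this
  have := le_of_tendsto' lim fun n => main n t ⟨ht, le_rfl⟩ x
  exact nonneg_of_mul_nonneg_right this (Real.exp_pos _)

/-- Transition kernel of the walk on `ℤ` with step distribution `p`. -/
noncomputable def walkKer (p : ℤ → ℝ) (x y : ℤ) : ℝ≥0∞ := ENNReal.ofReal (p (y - x))

/-- Extended nonnegative version of `convPow`. -/
noncomputable def convPowENN (p : ℤ → ℝ) : ℕ → ℤ → ℝ≥0∞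
  | 0 => fun x => if x = 0 then 1 else 0
  | n + 1 => fun x => ∑' y : ℤ, convPowENN p n y * ENNReal.ofReal (p (x - y))

section Walk

variable {p : ℤ → ℝ}

lemma summable_of_tsum_eq_one (hsum : ∑' i : ℤ, p i = 1) : Summable p := by
  by_contra h
  simp [tsum_eq_zero_of_not_summable h] at hsum

lemma summable_sub_right (hsum : ∑' i : ℤ, p i = 1) (x : ℤ) : Summable fun z => p (z - x) :=
  (Equiv.subRight x).summable_iff.2 (summable_of_tsum_eq_one hsum)

lemma tsum_sub_right (hsum : ∑' i : ℤ, p i = 1) (x : ℤ) : ∑' z, p (z - x) = 1 :=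
  ((Equiv.subRight x).tsum_eq p).trans hsum

lemma tsum_walkKer (hp0 : ∀ i, 0 ≤ p i) (hsum : ∑' i : ℤ, p i = 1) (x : ℤ) :
    ∑' y, walkKer p x y = 1 := by
  simp_rw [walkKer]
  rw [← ENNReal.ofReal_tsum_of_nonneg (fun y => hp0 _) (summable_sub_right hsum x),
    tsum_sub_right hsum, ENNReal.ofReal_one]

lemma walkKer_symm (hsym : ∀ i, p (-i) = p i) (x y : ℤ) : walkKer p x y = walkKer p y x := by
  rw [walkKer, walkKer, ← hsym, neg_sub]

lemma iterate_walkKer (n : ℕ) (f : ℤ → ℝ≥0∞) (k : ℤ) :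
    (kerOp (walkKer p))^[n] f k = ∑' y, convPowENN p n (y - k) * f y := by
  induction n generalizing f with
  | zero =>
    rw [tsum_eq_single k]
    · simp [convPowENN]
    · intro y hy
      simp [convPowENN, sub_eq_zero, hy]
  | succ n ih =>
    rw [Function.iterate_succ_apply, ih]
    simp_rw [kerOp, convPowENN, ← ENNReal.tsum_mul_left, ← ENNReal.tsum_mul_right]
    rw [ENNReal.tsum_comm]
    refine tsum_congr fun w => ?_
    rw [← (Equiv.subRight k).tsum_eq
      (fun y => convPowENN p n y * ENNReal.ofReal (p (w - k - y)) * f w)]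
    refine tsum_congr fun y => ?_
    simp only [walkKer, Equiv.subRight_apply, sub_sub_sub_cancel_right, mul_assoc]

lemma convPowENN_le_one (hp0 : ∀ i, 0 ≤ p i) (hsum : ∑' i : ℤ, p i = 1) (n : ℕ) (x : ℤ) :
    convPowENN p n x ≤ 1 := by
  have h := iterate_kerOp_le_one (fun x => (tsum_walkKer hp0 hsum x).le)
    (f := fun _ => 1) (fun _ => le_rfl) n 0
  rw [iterate_walkKer] at h
  simp only [sub_zero, mul_one] at h
  exact (ENNReal.le_tsum x).trans h

lemma toReal_convPowENN (hp0 : ∀ i, 0 ≤ p i) (hsum : ∑' i : ℤ, p i = 1) (n : ℕ) (x : ℤ) :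
    (convPowENN p n x).toReal = convPow p n x := by
  induction n generalizing x with
  | zero => simp only [convPowENN, convPow]; split_ifs <;> simp
  | succ n ih =>
    rw [convPowENN, convPow, ENNReal.tsum_toReal_eq]
    · simp_rw [ENNReal.toReal_mul, ih, ENNReal.toReal_ofReal (hp0 _)]
    · exact fun y => ENNReal.mul_ne_top
        ((convPowENN_le_one hp0 hsum n y).trans_lt ENNReal.one_lt_top).ne ENNReal.ofReal_ne_top

lemma ctPMF_eq_toReal (hp0 : ∀ i, 0 ≤ p i) (hsum : ∑' i : ℤ, p i = 1) {t : ℝ} (ht : 0 ≤ t)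
    (x : ℤ) : ctPMF p t x = (∑' n, poissonWeight t n * convPowENN p n x).toReal := by
  rw [ctPMF, ENNReal.tsum_toReal_eq]
  · simp_rw [ENNReal.toReal_mul, toReal_convPowENN hp0 hsum, toReal_poissonWeight ht]
  · exact fun n => ENNReal.mul_ne_top (poissonWeight_ne_top _ _)
      ((convPowENN_le_one hp0 hsum n x).trans_lt ENNReal.one_lt_top).ne

lemma oneP_eq_toReal (hp0 : ∀ i, 0 ≤ p i) (hsum : ∑' i : ℤ, p i = 1) {t : ℝ} (ht : 0 ≤ t)
    {ρ : ℤ → ℝ} (hρ : ∀ k, 0 ≤ ρ k) (k : ℤ) :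
    oneP p ρ t k = (kerSemi (walkKer p) t (fun j => ENNReal.ofReal (ρ j)) k).toReal := by
  simp_rw [kerSemi, iterate_walkKer, ← ENNReal.tsum_mul_left]
  rw [ENNReal.tsum_comm, oneP]
  simp_rw [← mul_assoc, ENNReal.tsum_mul_right]
  rw [ENNReal.tsum_toReal_eq]
  · simp_rw [ENNReal.toReal_mul, ENNReal.toReal_ofReal (hρ _), ctPMF_eq_toReal hp0 hsum ht]
  · refine fun y => ENNReal.mul_ne_top (ne_top_of_le_ne_top ENNReal.one_ne_top ?_)
      ENNReal.ofReal_ne_top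
    rw [← tsum_poissonWeight ht]
    exact ENNReal.tsum_le_tsum fun n => mul_le_of_le_one_right' (convPowENN_le_one hp0 hsum n _)

lemma toReal_kerOp_walkKer_sub (hp0 : ∀ i, 0 ≤ p i) (hsum : ∑' i : ℤ, p i = 1)
    {g : ℤ → ℝ≥0∞} (hg : ∀ k, g k ≤ 1) (x : ℤ) :
    (kerOp (walkKer p) g x).toReal - (g x).toReal
      = ∑' z, p (z - x) * ((g z).toReal - (g x).toReal) := by
  have hg1 : ∀ z, (g z).toReal ≤ 1 := fun z => ENNReal.toReal_mono ENNReal.one_ne_top (hg z)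
  have hs : Summable fun z => p (z - x) * (g z).toReal :=
    Summable.of_nonneg_of_le (fun z => mul_nonneg (hp0 _) ENNReal.toReal_nonneg)
      (fun z => mul_le_of_le_one_right (hp0 _) (hg1 z)) (summable_sub_right hsum x)
  simp_rw [mul_sub]
  rw [hs.tsum_sub ((summable_sub_right hsum x).mul_right _), tsum_mul_right,
    tsum_sub_right hsum, one_mul, kerOp, ENNReal.tsum_toReal_eq]
  · simp_rw [walkKer, ENNReal.toReal_mul, ENNReal.toReal_ofReal (hp0 _)]
  · exact fun y => ENNReal.mul_ne_top ENNReal.ofReal_ne_top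
      ((hg y).trans_lt ENNReal.one_lt_top).ne

end Walk

/-- Jump kernel of two exclusion particles, run at total rate `2` and killed on the diagonal. -/
noncomputable def pairKer (p : ℤ → ℝ) (s s' : ℤ × ℤ) : ℝ≥0∞ :=
  if s.1 = s.2 ∨ s'.1 = s'.2 then 0 else
    2⁻¹ * ((if s'.2 = s.2 then ENNReal.ofReal (p (s'.1 - s.1)) else 0)
      + (if s'.1 = s.1 then ENNReal.ofReal (p (s'.2 - s.2)) else 0)
      + (if s' = s then 2 * ENNReal.ofReal (p (s.2 - s.1)) else 0))

section Pair

variable {p : ℤ → ℝ}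

lemma pairKer_symm (hsym : ∀ i, p (-i) = p i) (s s' : ℤ × ℤ) : pairKer p s s' = pairKer p s' s := by
  rw [pairKer, pairKer]
  have h1 : p (s'.1 - s.1) = p (s.1 - s'.1) := by rw [← hsym, neg_sub]
  have h2 : p (s'.2 - s.2) = p (s.2 - s'.2) := by rw [← hsym, neg_sub]
  simp only [h1, h2, or_comm (a := s.1 = s.2), eq_comm (a := s'.2) (b := s.2),
    eq_comm (a := s'.1) (b := s.1)]
  by_cases h : s' = s
  · subst h; rfl
  · rw [if_neg h, if_neg (Ne.symm h)]

lemma kerOp_pairKer (F : ℤ × ℤ → ℝ≥0∞) {x y : ℤ} (hxy : x ≠ y) :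
    kerOp (pairKer p) F (x, y) = 2⁻¹ *
      ((∑' z, if z ≠ y then ENNReal.ofReal (p (z - x)) * F (z, y) else 0)
        + (∑' z, if z ≠ x then ENNReal.ofReal (p (z - y)) * F (x, z) else 0)
        + 2 * ENNReal.ofReal (p (y - x)) * F (x, y)) := by
  have h : ∀ s' : ℤ × ℤ, pairKer p (x, y) s' * F s' = 2⁻¹ *
      ((if s'.2 = y then (if s'.1 ≠ y then ENNReal.ofReal (p (s'.1 - x)) * F (s'.1, y) else 0)
          else 0)
        + (if s'.1 = x then (if s'.2 ≠ x then ENNReal.ofReal (p (s'.2 - y)) * F (x, s'.2) else 0)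
          else 0)
        + (if s' = (x, y) then 2 * ENNReal.ofReal (p (y - x)) * F (x, y) else 0)) := by
    rintro ⟨a, b⟩
    simp only [pairKer, hxy, false_or, Prod.mk.injEq]
    by_cases hb : b = y
    · subst hb
      by_cases ha : a = x
      · subst ha
        simp only [hxy, hxy.symm, if_false, if_true, ne_eq, not_false_eq_true, and_self]
        ring
      · by_cases hab : a = b
        · subst hab; simp [ha]
        · simp [ha, hab, mul_assoc]
    · by_cases ha : a = x
      · subst ha
        by_cases hab : a = b
        · simp [hb, hab]
        · simp [hb, hab, Ne.symm hab]; ring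
      · simp [ha, hb]
  rw [kerOp, tsum_congr h, ENNReal.tsum_mul_left, ENNReal.tsum_add, ENNReal.tsum_add,
    tsum_ite_eq]
  congr 3
  · rw [ENNReal.tsum_prod']
    exact tsum_congr fun a => tsum_ite_eq _ _
  · rw [ENNReal.tsum_prod', ENNReal.tsum_comm]
    exact tsum_congr fun a => tsum_ite_eq _ _

lemma summable_ite_ne (hsum : ∑' i : ℤ, p i = 1) (hp0 : ∀ i, 0 ≤ p i) {f : ℤ → ℝ} {C : ℝ}
    {y : ℤ} (hf : ∀ z, z ≠ y → |f z| ≤ C) (x : ℤ) :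
    Summable fun z => if z ≠ y then p (z - x) * f z else 0 := by
  refine Summable.of_norm_bounded ((summable_sub_right hsum x).mul_right |C|) fun z => ?_
  split_ifs with h
  · rw [norm_mul, Real.norm_eq_abs, Real.norm_eq_abs, abs_of_nonneg (hp0 _)]
    exact mul_le_mul_of_nonneg_left ((hf z h).trans (le_abs_self C)) (hp0 _)
  · simpa using mul_nonneg (hp0 _) (abs_nonneg _)

lemma tsum_ite_ne (hsum : ∑' i : ℤ, p i = 1) (x y : ℤ) :
    ∑' z, (if z ≠ y then p (z - x) else 0) = 1 - p (y - x) := by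
  have h := (summable_sub_right hsum x).tsum_eq_add_tsum_ite y
  rw [tsum_sub_right hsum] at h
  simp only [ne_eq, ite_not]
  linarith

lemma tsum_ite_ne_const (hsum : ∑' i : ℤ, p i = 1) (x y : ℤ) (c : ℝ) :
    ∑' z, (if z ≠ y then p (z - x) * c else 0) = (1 - p (y - x)) * c := by
  rw [← tsum_ite_ne hsum, ← tsum_mul_right]
  simp only [ite_mul, zero_mul]

lemma tsum_ite_ne_sub (hsum : ∑' i : ℤ, p i = 1) (hp0 : ∀ i, 0 ≤ p i) {f : ℤ → ℝ} {C : ℝ}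
    {y : ℤ} (hf : ∀ z, z ≠ y → |f z| ≤ C) (x : ℤ) (c : ℝ) :
    ∑' z, (if z ≠ y then p (z - x) * (f z - c) else 0)
      = ∑' z, (if z ≠ y then p (z - x) * f z else 0) - (1 - p (y - x)) * c := by
  rw [← tsum_ite_ne_const hsum, ← (summable_ite_ne hsum hp0 hf x).tsum_sub
    (summable_ite_ne hsum hp0 (f := fun _ => c) (fun _ _ => le_rfl) x)]
  refine tsum_congr fun z => ?_
  split_ifs <;> ring

lemma twoGen_eq (hsum : ∑' i : ℤ, p i = 1) (hp0 : ∀ i, 0 ≤ p i) {f : ℤ → ℤ → ℝ} {C : ℝ}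
    (hf : ∀ a b, a ≠ b → |f a b| ≤ C) (x y : ℤ) :
    twoGen p f x y = ∑' z, (if z ≠ y then p (z - x) * f z y else 0)
      + ∑' z, (if z ≠ x then p (z - y) * f x z else 0)
      - (1 - p (y - x) + (1 - p (x - y))) * f x y := by
  rw [twoGen, tsum_ite_ne_sub hsum hp0 (fun z hz => hf z y hz),
    tsum_ite_ne_sub hsum hp0 (fun z hz => hf x z hz.symm)]
  ring

lemma twoGen_sub (hsum : ∑' i : ℤ, p i = 1) (hp0 : ∀ i, 0 ≤ p i) {f g : ℤ → ℤ → ℝ} {C : ℝ}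
    (hf : ∀ a b, a ≠ b → |f a b| ≤ C) (hg : ∀ a b, a ≠ b → |g a b| ≤ C) (x y : ℤ) :
    twoGen p (fun a b => f a b - g a b) x y = twoGen p f x y - twoGen p g x y := by
  have hfg : ∀ a b, a ≠ b → |f a b - g a b| ≤ C + C := fun a b h =>
    (abs_sub _ _).trans (add_le_add (hf a b h) (hg a b h))
  have e1 : ∑' z, (if z ≠ y then p (z - x) * (f z y - g z y) else 0)
      = ∑' z, (if z ≠ y then p (z - x) * f z y else 0)
        - ∑' z, (if z ≠ y then p (z - x) * g z y else 0) := by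
    rw [← (summable_ite_ne hsum hp0 (fun z hz => hf z y hz) x).tsum_sub
      (summable_ite_ne hsum hp0 (fun z hz => hg z y hz) x)]
    refine tsum_congr fun z => ?_
    split_ifs <;> ring
  have e2 : ∑' z, (if z ≠ x then p (z - y) * (f x z - g x z) else 0)
      = ∑' z, (if z ≠ x then p (z - y) * f x z else 0)
        - ∑' z, (if z ≠ x then p (z - y) * g x z else 0) := by
    rw [← (summable_ite_ne hsum hp0 (fun z hz => hf x z hz.symm) y).tsum_sub
      (summable_ite_ne hsum hp0 (fun z hz => hg x z hz.symm) y)]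
    refine tsum_congr fun z => ?_
    split_ifs <;> ring
  rw [twoGen_eq hsum hp0 hfg, twoGen_eq hsum hp0 hf, twoGen_eq hsum hp0 hg, e1, e2]
  ring

lemma le_tsum_ite_ne (hsum : ∑' i : ℤ, p i = 1) (hp0 : ∀ i, 0 ≤ p i) {f : ℤ → ℝ} {C M : ℝ}
    {y : ℤ} (hf : ∀ z, z ≠ y → |f z| ≤ C) (hM : ∀ z, z ≠ y → -M ≤ f z) (x : ℤ) :
    -((1 - p (y - x)) * M) ≤ ∑' z, (if z ≠ y then p (z - x) * f z else 0) := by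
  rw [← mul_neg, ← tsum_ite_ne_const hsum]
  refine (summable_ite_ne hsum hp0 (f := fun _ => -M) (fun _ _ => le_rfl) x).tsum_le_tsum
    (fun z => ?_) (summable_ite_ne hsum hp0 hf x)
  split_ifs with h
  · exact mul_le_mul_of_nonneg_left (hM z h) (hp0 _)
  · exact le_rfl

lemma le_twoGen (hsum : ∑' i : ℤ, p i = 1) (hp0 : ∀ i, 0 ≤ p i) {f : ℤ → ℤ → ℝ} {C M : ℝ}
    (hf : ∀ a b, a ≠ b → |f a b| ≤ C) (hM : ∀ a b, a ≠ b → -M ≤ f a b) {x y : ℤ} (hxy : x ≠ y) :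
    -(2 * (M + f x y)) ≤ twoGen p f x y := by
  rw [twoGen_eq hsum hp0 hf]
  have h1 := le_tsum_ite_ne hsum hp0 (fun z hz => hf z y hz) (fun z hz => hM z y hz) x
  have h2 := le_tsum_ite_ne hsum hp0 (fun z hz => hf x z hz.symm) (fun z hz => hM x z hz.symm) y
  have h3 := hM x y hxy
  nlinarith [mul_nonneg (hp0 (y - x)) (by linarith : 0 ≤ M + f x y),
    mul_nonneg (hp0 (x - y)) (by linarith : 0 ≤ M + f x y)]

lemma tsum_pairKer_le_one (hsum : ∑' i : ℤ, p i = 1) (hp0 : ∀ i, 0 ≤ p i)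
    (hsym : ∀ i, p (-i) = p i) (s : ℤ × ℤ) : ∑' s', pairKer p s s' ≤ 1 := by
  obtain ⟨x, y⟩ := s
  by_cases hxy : x = y
  · subst hxy; simp [pairKer]
  have h := kerOp_pairKer (p := p) (fun _ => 1) hxy
  simp only [kerOp, mul_one] at h
  have e : ∀ x y : ℤ, ∑' z, (if z ≠ y then ENNReal.ofReal (p (z - x)) else 0)
      + ENNReal.ofReal (p (y - x)) = 1 := fun x y => by
    have := ENNReal.tsum_eq_add_tsum_ite (f := fun z => walkKer p x z) y
    rw [tsum_walkKer hp0 hsum] at this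
    simp only [ne_eq, ite_not]
    rw [this, add_comm]
    simp only [walkKer]
    congr!
  have e' := e y x
  rw [← hsym, neg_sub] at e'
  rw [h, two_mul, add_add_add_comm, e, e', one_add_one_eq_two,
    ENNReal.inv_mul_cancel two_ne_zero ENNReal.ofNat_ne_top]

lemma toReal_kerOp_pairKer_sub (hsum : ∑' i : ℤ, p i = 1) (hp0 : ∀ i, 0 ≤ p i)
    (hsym : ∀ i, p (-i) = p i) {F : ℤ × ℤ → ℝ≥0∞} (hF : ∀ s, F s ≤ 1) {x y : ℤ} (hxy : x ≠ y) :
    2 * ((kerOp (pairKer p) F (x, y)).toReal - (F (x, y)).toReal)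
      = twoGen p (fun a b => (F (a, b)).toReal) x y := by
  have hb : ∀ a b, a ≠ b → |(F (a, b)).toReal| ≤ 1 := fun a b _ => by
    rw [abs_of_nonneg ENNReal.toReal_nonneg]
    exact ENNReal.toReal_mono ENNReal.one_ne_top (hF _)
  have hFt : ∀ s, F s ≠ ⊤ := fun s => ((hF s).trans_lt ENNReal.one_lt_top).ne
  have e : ∀ (x y : ℤ) (g : ℤ → ℝ≥0∞), (∀ z, g z ≤ 1) →
      (∑' z, if z ≠ y then ENNReal.ofReal (p (z - x)) * g z else 0) ≠ ⊤ ∧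
      (∑' z, if z ≠ y then ENNReal.ofReal (p (z - x)) * g z else 0).toReal
        = ∑' z, if z ≠ y then p (z - x) * (g z).toReal else 0 := by
    intro x y g hg
    constructor
    · refine ne_top_of_le_ne_top ENNReal.one_ne_top ?_
      rw [← tsum_walkKer hp0 hsum x]
      refine ENNReal.tsum_le_tsum fun z => ?_
      split_ifs
      · exact mul_le_of_le_one_right' (hg z)
      · exact zero_le
    · rw [ENNReal.tsum_toReal_eq]
      · refine tsum_congr fun z => ?_
        split_ifs
        · rw [ENNReal.toReal_mul, ENNReal.toReal_ofReal (hp0 _)]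
        · rfl
      · intro z
        split_ifs
        · exact ENNReal.mul_ne_top ENNReal.ofReal_ne_top
            ((hg z).trans_lt ENNReal.one_lt_top).ne
        · exact ENNReal.zero_ne_top
  obtain ⟨t1, r1⟩ := e x y (fun z => F (z, y)) fun z => hF _
  obtain ⟨t2, r2⟩ := e y x (fun z => F (x, z)) fun z => hF _
  have hp : p (x - y) = p (y - x) := by rw [← hsym, neg_sub]
  rw [twoGen_eq hsum hp0 hb, kerOp_pairKer F hxy, ENNReal.toReal_mul, ENNReal.toReal_add
    (ENNReal.add_ne_top.2 ⟨t1, t2⟩) (ENNReal.mul_ne_top (ENNReal.mul_ne_top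
      ENNReal.ofNat_ne_top ENNReal.ofReal_ne_top) (hFt _)), ENNReal.toReal_add t1 t2, r1, r2,
    ENNReal.toReal_mul, ENNReal.toReal_mul, ENNReal.toReal_ofReal (hp0 _), ENNReal.toReal_inv, hp]
  simp only [ENNReal.toReal_ofNat]
  ring

lemma hasDerivWithinAt_pairSemi (hsum : ∑' i : ℤ, p i = 1) (hp0 : ∀ i, 0 ≤ p i)
    (hsym : ∀ i, p (-i) = p i) {F : ℤ × ℤ → ℝ≥0∞} (hF : ∀ s, F s ≤ 1) {x y : ℤ} (hxy : x ≠ y)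
    {t : ℝ} (ht : 0 ≤ t) :
    HasDerivWithinAt (fun s => (kerSemi (pairKer p) (2 * s) F (x, y)).toReal)
      (twoGen p (fun a b => (kerSemi (pairKer p) (2 * t) F (a, b)).toReal) x y)
      (Set.Ici 0) t := by
  have hq := tsum_pairKer_le_one hsum hp0 hsym
  have ht2 : 0 ≤ 2 * t := by positivity
  rw [← toReal_kerOp_pairKer_sub hsum hp0 hsym (fun s => kerSemi_le_one hq hF ht2 s) hxy]
  have h1 : HasDerivWithinAt (fun s : ℝ => 2 * s) 2 (Set.Ici 0) t := by
    simpa using ((hasDerivAt_id t).const_mul 2).hasDerivWithinAt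
  have := (hasDerivWithinAt_kerSemi hq hF ht2 (x, y)).scomp t h1
    (fun s (hs : 0 ≤ s) => show 0 ≤ 2 * s by positivity)
  exact this

end Pair

/-- The product function `g ⊗ g` set to zero on the diagonal. -/
noncomputable def offDiag (g : ℤ → ℝ≥0∞) (s : ℤ × ℤ) : ℝ≥0∞ :=
  if s.1 = s.2 then 0 else g s.1 * g s.2

lemma offDiag_le_one {g : ℤ → ℝ≥0∞} (hg : ∀ k, g k ≤ 1) (s : ℤ × ℤ) : offDiag g s ≤ 1 := by
  rw [offDiag]
  split_ifs
  · exact zero_le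
  · exact mul_le_one' (hg _) (hg _)

lemma offDiag_mono {f g : ℤ → ℝ≥0∞} (h : ∀ k, f k ≤ g k) (s : ℤ × ℤ) :
    offDiag f s ≤ offDiag g s := by
  rw [offDiag, offDiag]
  split_ifs
  · exact le_rfl
  · exact mul_le_mul' (h _) (h _)

lemma offDiag_mul (f g : ℤ → ℝ≥0∞) (s : ℤ × ℤ) :
    offDiag (fun k => f k * g k) s = offDiag f s * (g s.1 * g s.2) := by
  rw [offDiag, offDiag]
  split_ifs
  · rw [zero_mul]
  · ring

lemma sq_tsum_eq (F : ℤ → ℝ≥0∞) :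
    (∑' a, F a) ^ 2 = ∑' a, F a ^ 2 + ∑' s, offDiag F s := by
  have h1 : (∑' a, F a) ^ 2 = ∑' s : ℤ × ℤ, F s.1 * F s.2 := by
    rw [ENNReal.tsum_prod', sq, ← ENNReal.tsum_mul_right]
    exact tsum_congr fun a => ENNReal.tsum_mul_left.symm
  have h2 : ∑' a, F a ^ 2 = ∑' s : ℤ × ℤ, if s.2 = s.1 then F s.1 ^ 2 else 0 := by
    rw [ENNReal.tsum_prod']
    exact tsum_congr fun a => (tsum_ite_eq a fun _ => F a ^ 2).symm
  rw [h1, h2, ← ENNReal.tsum_add]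
  refine tsum_congr fun s => ?_
  rw [offDiag]
  by_cases h : s.1 = s.2
  · simp [h, sq]
  · simp [h, Ne.symm h]

section Exclusion

variable {p : ℤ → ℝ}

lemma abs_toReal_kerSemi_le_one {S : Type*} {q : S → S → ℝ≥0∞} (hq : ∀ x, ∑' y, q x y ≤ 1)
    {f : S → ℝ≥0∞} (hf : ∀ x, f x ≤ 1) {t : ℝ} (ht : 0 ≤ t) (x : S) :
    |(kerSemi q t f x).toReal| ≤ 1 := by
  rw [abs_of_nonneg ENNReal.toReal_nonneg]
  exact ENNReal.toReal_mono ENNReal.one_ne_top (kerSemi_le_one hq hf ht x)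

/-- Comparison principle for bounded solutions of the two-particle Kolmogorov equation. -/
lemma le_of_twoGen (hsum : ∑' i : ℤ, p i = 1) (hp0 : ∀ i, 0 ≤ p i) {f g : ℝ → ℤ → ℤ → ℝ}
    (hf : ∀ t, 0 ≤ t → ∀ j k, j ≠ k → |f t j k| ≤ 1)
    (hg : ∀ t, 0 ≤ t → ∀ j k, j ≠ k → |g t j k| ≤ 1) {c : ℝ → ℤ → ℤ → ℝ}
    (hc : ∀ t, 0 ≤ t → ∀ j k, 0 ≤ c t j k)
    (hfd : ∀ j k, j ≠ k → ∀ t, 0 ≤ t →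
      HasDerivWithinAt (fun s => f s j k) (twoGen p (f t) j k) (Set.Ici 0) t)
    (hgd : ∀ j k, j ≠ k → ∀ t, 0 ≤ t →
      HasDerivWithinAt (fun s => g s j k) (twoGen p (g t) j k + c t j k) (Set.Ici 0) t)
    (h0 : ∀ j k, j ≠ k → f 0 j k ≤ g 0 j k) {t : ℝ} (ht : 0 ≤ t) {j k : ℤ} (hjk : j ≠ k) :
    f t j k ≤ g t j k := by
  have hgf : ∀ t, 0 ≤ t → ∀ j k, j ≠ k → |g t j k - f t j k| ≤ 2 := fun t ht j k h => by
    have := (abs_sub (g t j k) (f t j k)).trans (add_le_add (hg t ht j k h) (hf t ht j k h))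
    linarith
  have := nonneg_of_generator_bound (S := {s : ℤ × ℤ // s.1 ≠ s.2}) (r := 2) (C := 2)
    (w := fun t s => g t s.1.1 s.1.2 - f t s.1.1 s.1.2)
    (w' := fun t s => twoGen p (g t) s.1.1 s.1.2 + c t s.1.1 s.1.2 - twoGen p (f t) s.1.1 s.1.2)
    zero_le_two zero_le_two
    (fun s t ht => (hgd _ _ s.2 t ht).sub (hfd _ _ s.2 t ht))
    (fun t ht M _ hw s => by
      have h1 := le_twoGen hsum hp0 (f := fun a b => g t a b - f t a b) (hgf t ht)
        (fun a b hab => hw ⟨(a, b), hab⟩) s.2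
      rw [twoGen_sub hsum hp0 (hg t ht) (hf t ht)] at h1
      have h2 := hc t ht s.1.1 s.1.2
      linarith)
    (fun t ht s => (abs_le.1 (hgf t ht _ _ s.2)).1)
    (fun s => sub_nonneg.2 (h0 _ _ s.2)) ht ⟨(j, k), hjk⟩
  exact sub_nonneg.1 this

/-- Bounded solutions of the two-particle equation are given by the two-particle semigroup. -/
lemma correlation_eq_pairSemi (hsum : ∑' i : ℤ, p i = 1) (hp0 : ∀ i, 0 ≤ p i)
    (hsym : ∀ i, p (-i) = p i) {ρ : ℤ → ℝ} (hρ01 : ∀ k, 0 ≤ ρ k ∧ ρ k ≤ 1)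
    {h : ℝ → ℤ → ℤ → ℝ} (h0 : ∀ j k : ℤ, j ≠ k → h 0 j k = ρ j * ρ k)
    (hbdd : ∀ (t : ℝ) (j k : ℤ), 0 ≤ h t j k ∧ h t j k ≤ 1)
    (hderiv : ∀ j k : ℤ, j ≠ k → ∀ t : ℝ, 0 ≤ t →
      HasDerivWithinAt (fun s => h s j k) (twoGen p (h t) j k) (Set.Ici 0) t)
    {t : ℝ} (ht : 0 ≤ t) {j k : ℤ} (hjk : j ≠ k) :
    h t j k
      = (kerSemi (pairKer p) (2 * t) (offDiag fun i => ENNReal.ofReal (ρ i)) (j, k)).toReal := by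
  have hq := tsum_pairKer_le_one hsum hp0 hsym
  have hF := offDiag_le_one (g := fun i => ENNReal.ofReal (ρ i))
    fun k => ENNReal.ofReal_le_one.2 (hρ01 k).2
  set V : ℝ → ℤ → ℤ → ℝ := fun t a b =>
    (kerSemi (pairKer p) (2 * t) (offDiag fun i => ENNReal.ofReal (ρ i)) (a, b)).toReal
  have hb : ∀ t, 0 ≤ t → ∀ j k, j ≠ k → |h t j k| ≤ 1 := fun t _ j k _ => by
    rw [abs_of_nonneg (hbdd t j k).1]; exact (hbdd t j k).2
  have hVb : ∀ t, 0 ≤ t → ∀ j k, j ≠ k → |V t j k| ≤ 1 := fun t ht j k _ =>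
    abs_toReal_kerSemi_le_one hq hF (by positivity) _
  have hVd : ∀ j k, j ≠ k → ∀ t, 0 ≤ t →
      HasDerivWithinAt (fun s => V s j k) (twoGen p (V t) j k) (Set.Ici 0) t :=
    fun j k hjk t ht => hasDerivWithinAt_pairSemi hsum hp0 hsym hF hjk ht
  have hV0 : ∀ j k, j ≠ k → h 0 j k = V 0 j k := fun j k hjk => by
    simp only [V, mul_zero, kerSemi_zero, offDiag, hjk, if_false, ENNReal.toReal_mul,
      ENNReal.toReal_ofReal (hρ01 _).1, h0 j k hjk]
  apply le_antisymm
  · exact le_of_twoGen hsum hp0 hb hVb (c := fun _ _ _ => 0) (fun _ _ _ _ => le_rfl) hderiv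
      (by simpa using hVd) (fun j k hjk => (hV0 j k hjk).le) ht hjk
  · exact le_of_twoGen hsum hp0 hVb hb (c := fun _ _ _ => 0) (fun _ _ _ _ => le_rfl) hVd
      (by simpa using hderiv) (fun j k hjk => (hV0 j k hjk).ge) ht hjk

lemma tsum_mul_eq_ite_ne (hsum : ∑' i : ℤ, p i = 1) (hp0 : ∀ i, 0 ≤ p i) {u : ℤ → ℝ}
    (hu : ∀ k, |u k| ≤ 1) (a b : ℤ) (v : ℝ) :
    (∑' z, p (z - a) * (u z - u a)) * v
      = ∑' z, (if z ≠ b then p (z - a) * (u z * v - u a * v) else 0)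
        + p (b - a) * (u b - u a) * v := by
  have hs : Summable fun z => p (z - a) * (u z - u a) := by
    refine Summable.of_norm_bounded ((summable_sub_right hsum a).mul_right 2) fun z => ?_
    rw [norm_mul, Real.norm_eq_abs, Real.norm_eq_abs, abs_of_nonneg (hp0 _)]
    refine mul_le_mul_of_nonneg_left ?_ (hp0 _)
    have := (abs_sub (u z) (u a)).trans (add_le_add (hu z) (hu a))
    linarith
  have h := hs.tsum_eq_add_tsum_ite b
  rw [h, add_mul, add_comm, ← tsum_mul_right]
  congr 1
  refine tsum_congr fun z => ?_
  by_cases hz : z = b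
  · simp [hz]
  · simp only [hz, if_false, ne_eq, not_false_eq_true, if_true]
    ring

/-- Liggett's inequality: the exclusion semigroup is dominated by that of independent walks on
product functions. -/
lemma pairSemi_le_mul (hsum : ∑' i : ℤ, p i = 1) (hp0 : ∀ i, 0 ≤ p i)
    (hsym : ∀ i, p (-i) = p i) {g : ℤ → ℝ≥0∞} (hg : ∀ k, g k ≤ 1) {t : ℝ} (ht : 0 ≤ t)
    {j k : ℤ} (hjk : j ≠ k) :
    kerSemi (pairKer p) (2 * t) (offDiag g) (j, k)
      ≤ kerSemi (walkKer p) t g j * kerSemi (walkKer p) t g k := by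
  have hq := tsum_pairKer_le_one hsum hp0 hsym
  have hw : ∀ x, ∑' y, walkKer p x y ≤ 1 := fun x => (tsum_walkKer hp0 hsum x).le
  have hF := offDiag_le_one hg
  set u : ℝ → ℤ → ℝ := fun t a => (kerSemi (walkKer p) t g a).toReal
  have hu : ∀ t, 0 ≤ t → ∀ a, |u t a| ≤ 1 := fun t ht a => abs_toReal_kerSemi_le_one hw hg ht a
  have hud : ∀ a t, 0 ≤ t →
      HasDerivWithinAt (fun s => u s a) (∑' z, p (z - a) * (u t z - u t a)) (Set.Ici 0) t :=
    fun a t ht => by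
      rw [← toReal_kerOp_walkKer_sub hp0 hsum (fun k => kerSemi_le_one hw hg ht k)]
      exact hasDerivWithinAt_kerSemi hw hg ht a
  have key := le_of_twoGen hsum hp0
    (f := fun t a b => (kerSemi (pairKer p) (2 * t) (offDiag g) (a, b)).toReal)
    (g := fun t a b => u t a * u t b)
    (c := fun t a b => p (b - a) * (u t b - u t a) ^ 2)
    (fun t ht j k _ => abs_toReal_kerSemi_le_one hq hF (by positivity) _)
    (fun t ht j k _ => by
      rw [abs_mul]; exact mul_le_one₀ (hu t ht j) (abs_nonneg _) (hu t ht k))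
    (fun t _ j k => mul_nonneg (hp0 _) (sq_nonneg _))
    (fun j k hjk t ht => hasDerivWithinAt_pairSemi hsum hp0 hsym hF hjk ht)
    (fun j k hjk t ht => by
      refine ((hud j t ht).mul (hud k t ht)).congr_deriv ?_
      have hp : p (j - k) = p (k - j) := by rw [← hsym, neg_sub]
      rw [mul_comm (u t j), tsum_mul_eq_ite_ne hsum hp0 (hu t ht) j k,
        tsum_mul_eq_ite_ne hsum hp0 (hu t ht) k j, twoGen, hp]
      simp only [mul_comm _ (u t j)]
      ring)
    (fun j k hjk => by
      simp only [u, mul_zero, kerSemi_zero, offDiag, hjk, if_false, ENNReal.toReal_mul, le_refl])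
    ht hjk
  rw [← ENNReal.toReal_mul] at key
  exact (ENNReal.toReal_le_toReal (kerSemi_ne_top hq hF (by positivity) _)
    (ENNReal.mul_ne_top (kerSemi_ne_top hw hg ht _) (kerSemi_ne_top hw hg ht _))).1 key

lemma iterate_walkKer_exp (hp0 : ∀ i, 0 ≤ p i) {θ : ℝ}
    (hexp : Summable fun i : ℤ => Real.exp (θ * (i : ℝ)) * p i) (n : ℕ) (x : ℤ) :
    (kerOp (walkKer p))^[n] (fun y => ENNReal.ofReal (Real.exp (θ * y))) x
      = ENNReal.ofReal (∑' i : ℤ, Real.exp (θ * i) * p i) ^ n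
        * ENNReal.ofReal (Real.exp (θ * x)) := by
  induction n generalizing x with
  | zero => simp
  | succ n ih =>
    rw [Function.iterate_succ_apply', kerOp]
    simp_rw [ih]
    rw [pow_succ]
    generalize ENNReal.ofReal (∑' i : ℤ, Real.exp (θ * i) * p i) ^ n = c
    rw [ENNReal.ofReal_tsum_of_nonneg (fun i => mul_nonneg (Real.exp_pos _).le (hp0 i))
      hexp, mul_assoc, ← ENNReal.tsum_mul_right, ← ENNReal.tsum_mul_left,
      ← (Equiv.subRight x).tsum_eq (fun i : ℤ =>
        c * (ENNReal.ofReal (Real.exp (θ * i) * p i) * ENNReal.ofReal (Real.exp (θ * x))))]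
    refine tsum_congr fun y => ?_
    rw [walkKer, mul_left_comm, ← ENNReal.ofReal_mul (hp0 _),
      ← ENNReal.ofReal_mul (mul_nonneg (Real.exp_pos _).le (hp0 _))]
    congr 2
    rw [Equiv.subRight_apply, mul_right_comm, ← Real.exp_add, mul_comm]
    push_cast
    ring_nf

lemma summable_exp_nonpos {θ : ℝ} (hθ : 0 < θ) :
    Summable fun a : ℤ => if a ≤ 0 then Real.exp (θ * a) else 0 := by
  have hgeo : Summable fun n : ℕ => Real.exp (-θ) ^ n :=
    summable_geometric_of_lt_one (Real.exp_pos _).le (Real.exp_lt_one_iff.2 (by linarith))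
  have h : Summable fun a : ℤ => Real.exp (-θ) ^ a.natAbs :=
    Summable.of_nat_of_neg (by simpa using hgeo) (by simpa using hgeo)
  refine Summable.of_nonneg_of_le (fun a => by split_ifs <;> positivity) (fun a => ?_) h
  split_ifs with ha
  · rw [← Real.exp_nat_mul]
    have : ((a.natAbs : ℕ) : ℝ) = -(a : ℝ) := by
      rw [Nat.cast_natAbs, abs_of_nonpos ha, Int.cast_neg]
    rw [this]
    apply le_of_eq
    ring_nf
  · positivity

/-- Indicator of the half-line `(z, ∞)`. -/
noncomputable def indGt (z : ℝ) (k : ℤ) : ℝ≥0∞ := if z < (k : ℝ) then 1 else 0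

lemma indGt_le_one (z : ℝ) (k : ℤ) : indGt z k ≤ 1 := by
  rw [indGt]; split_ifs <;> simp

lemma tsum_walkSemi_indGt_mul_ne_top (hp0 : ∀ i, 0 ≤ p i) {θ : ℝ} (hθ : 0 < θ)
    (hexp : Summable fun i : ℤ => Real.exp (θ * (i : ℝ)) * p i) {t : ℝ} (ht : 0 ≤ t) (z : ℝ)
    {r : ℤ → ℝ≥0∞} (hr : ∀ k, r k ≤ 1) (hrpos : ∀ k : ℤ, 0 < k → r k = 0) :
    ∑' a, kerSemi (walkKer p) t (indGt z) a * r a ≠ ⊤ := by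
  set m := ∑' i : ℤ, Real.exp (θ * i) * p i
  have hm : 0 ≤ m := tsum_nonneg fun i => mul_nonneg (Real.exp_pos _).le (hp0 i)
  set c := ENNReal.ofReal (Real.exp (-(θ * z)))
  set E : ℤ → ℝ≥0∞ := fun y => ENNReal.ofReal (Real.exp (θ * y))
  set K := ENNReal.ofReal (Real.exp (-t) * Real.exp (t * m))
  have hE : ∀ n x, (kerOp (walkKer p))^[n] (fun y => c * E y) x
      = c * (kerOp (walkKer p))^[n] E x := by
    intro n
    induction n with
    | zero => exact fun _ => rfl
    | succ n ih =>
      intro x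
      rw [Function.iterate_succ_apply', Function.iterate_succ_apply', kerOp, kerOp,
        ← ENNReal.tsum_mul_left]
      simp_rw [ih]
      exact tsum_congr fun y => mul_left_comm _ _ _
  have hI : ∀ y, indGt z y ≤ c * E y := by
    intro y
    rw [indGt]
    split_ifs with h
    · rw [← ENNReal.ofReal_mul (Real.exp_pos _).le, ← Real.exp_add, ENNReal.one_le_ofReal]
      refine Real.one_le_exp ?_
      nlinarith
    · exact zero_le
  have hG : ∀ a, kerSemi (walkKer p) t (indGt z) a ≤ c * K * E a := by
    intro a
    refine (kerSemi_mono hI t a).trans (le_of_eq ?_)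
    rw [kerSemi]
    simp_rw [hE, E, iterate_walkKer_exp hp0 hexp]
    simp_rw [mul_left_comm _ c, ENNReal.tsum_mul_left, ← mul_assoc (poissonWeight t _),
      ENNReal.tsum_mul_right]
    rw [tsum_poissonWeight_mul_pow ht hm, ← mul_assoc]
  have hle : ∑' a, kerSemi (walkKer p) t (indGt z) a * r a
      ≤ ∑' a : ℤ, c * K * ENNReal.ofReal (if a ≤ 0 then Real.exp (θ * a) else 0) := by
    refine ENNReal.tsum_le_tsum fun a => ?_
    by_cases ha : a ≤ 0
    · rw [if_pos ha]
      exact (mul_le_of_le_one_right' (hr a)).trans (hG a)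
    · rw [hrpos a (not_le.1 ha), mul_zero]
      exact zero_le
  refine ne_top_of_le_ne_top ?_ hle
  rw [ENNReal.tsum_mul_left, ← ENNReal.ofReal_tsum_of_nonneg
    (fun a => by split_ifs <;> positivity) (summable_exp_nonpos hθ)]
  exact ENNReal.mul_ne_top (ENNReal.mul_ne_top ENNReal.ofReal_ne_top ENNReal.ofReal_ne_top)
    ENNReal.ofReal_ne_top

/-- `E[N] - Var N` for the number `N` of particles in `(z, ∞)` at time `t`, expressed as a sum of
nonnegative terms over the initial positions. -/
noncomputable def meanSubVar (p : ℤ → ℝ) (t z : ℝ) (r : ℤ → ℝ≥0∞) : ℝ≥0∞ :=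
  ∑' a, (kerSemi (walkKer p) t (indGt z) a * r a) ^ 2
    + ∑' s : ℤ × ℤ, offDiag r s *
      (kerSemi (walkKer p) t (indGt z) s.1 * kerSemi (walkKer p) t (indGt z) s.2
        - kerSemi (pairKer p) (2 * t) (offDiag (indGt z)) s)

lemma meanSubVar_mono (p : ℤ → ℝ) (t z : ℝ) {r r' : ℤ → ℝ≥0∞} (h : ∀ k, r k ≤ r' k) :
    meanSubVar p t z r ≤ meanSubVar p t z r' := by
  refine add_le_add (ENNReal.tsum_le_tsum fun a => ?_) (ENNReal.tsum_le_tsum fun s => ?_)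
  · gcongr; exact h a
  · gcongr; exact offDiag_mono h s

lemma sq_tsum_eq_meanSubVar_add (hsum : ∑' i : ℤ, p i = 1) (hp0 : ∀ i, 0 ≤ p i)
    (hsym : ∀ i, p (-i) = p i) {t : ℝ} (ht : 0 ≤ t) (z : ℝ) (r : ℤ → ℝ≥0∞) :
    (∑' k, indGt z k * kerSemi (walkKer p) t r k) ^ 2
      = meanSubVar p t z r
        + ∑' s, offDiag (indGt z) s * kerSemi (pairKer p) (2 * t) (offDiag r) s := by
  rw [kerSemi_adjoint (walkKer_symm hsym), kerSemi_adjoint (pairKer_symm hsym), sq_tsum_eq,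
    meanSubVar, add_assoc, ← ENNReal.tsum_add]
  congr 1
  refine tsum_congr fun s => ?_
  rw [mul_comm (kerSemi (pairKer p) _ _ _), ← mul_add]
  by_cases hs : s.1 = s.2
  · simp [offDiag, hs]
  · rw [tsub_add_cancel_of_le (pairSemi_le_mul hsum hp0 hsym (indGt_le_one z) ht hs), ← offDiag_mul]
    simp_rw [mul_comm]

lemma eq_toReal_meanSubVar (hsum : ∑' i : ℤ, p i = 1) (hp0 : ∀ i, 0 ≤ p i)
    (hsym : ∀ i, p (-i) = p i) {θ : ℝ} (hθ : 0 < θ)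
    (hexp : Summable fun i : ℤ => Real.exp (θ * (i : ℝ)) * p i)
    {ρ : ℤ → ℝ} (hρ01 : ∀ k, 0 ≤ ρ k ∧ ρ k ≤ 1) (hρpos : ∀ k : ℤ, 0 < k → ρ k = 0)
    {h : ℝ → ℤ → ℤ → ℝ} (h0 : ∀ j k : ℤ, j ≠ k → h 0 j k = ρ j * ρ k)
    (hbdd : ∀ (t : ℝ) (j k : ℤ), 0 ≤ h t j k ∧ h t j k ≤ 1)
    (hderiv : ∀ j k : ℤ, j ≠ k → ∀ t : ℝ, 0 ≤ t →
      HasDerivWithinAt (fun s => h s j k) (twoGen p (h t) j k) (Set.Ici 0) t)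
    {t : ℝ} (ht : 0 ≤ t) (z : ℝ) :
    meanSubVar p t z (fun i => ENNReal.ofReal (ρ i)) ≠ ⊤ ∧
    (∑' k : ℤ, if z < (k : ℝ) then (oneP p ρ t k) ^ 2 else 0)
        + (∑' q : ℤ × ℤ, if q.1 ≠ q.2 ∧ z < (q.1 : ℝ) ∧ z < (q.2 : ℝ) then
            oneP p ρ t q.1 * oneP p ρ t q.2 - h t q.1 q.2 else 0)
      = (meanSubVar p t z (fun i => ENNReal.ofReal (ρ i))).toReal := by
  set r : ℤ → ℝ≥0∞ := fun i => ENNReal.ofReal (ρ i)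
  have hr : ∀ k, r k ≤ 1 := fun k => ENNReal.ofReal_le_one.2 (hρ01 k).2
  have hrpos : ∀ k : ℤ, 0 < k → r k = 0 := fun k hk => by simp [r, hρpos k hk]
  set u := kerSemi (walkKer p) t r
  set V := kerSemi (pairKer p) (2 * t) (offDiag r)
  have hN : (∑' k, indGt z k * u k) ^ 2 ≠ ⊤ := by
    rw [kerSemi_adjoint (walkKer_symm hsym)]
    exact ENNReal.pow_ne_top (tsum_walkSemi_indGt_mul_ne_top hp0 hθ hexp ht z hr hrpos)
  have e1 : (∑' k, indGt z k * u k) ^ 2 = meanSubVar p t z r + ∑' s, offDiag (indGt z) s * V s :=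
    sq_tsum_eq_meanSubVar_add hsum hp0 hsym ht z r
  have e2 := sq_tsum_eq fun k => indGt z k * u k
  obtain ⟨hK, hD⟩ := ENNReal.add_ne_top.1 (e1 ▸ hN)
  obtain ⟨hS1, hS2⟩ := ENNReal.add_ne_top.1 (e2 ▸ hN)
  refine ⟨hK, ?_⟩
  have hu : ∀ k, oneP p ρ t k = (u k).toReal := oneP_eq_toReal hp0 hsum ht fun k => (hρ01 k).1
  have f1 : (∑' k : ℤ, if z < (k : ℝ) then (oneP p ρ t k) ^ 2 else 0)
      = (∑' k, (indGt z k * u k) ^ 2).toReal := by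
    rw [ENNReal.tsum_toReal_eq fun k => ENNReal.ne_top_of_tsum_ne_top hS1 k]
    refine tsum_congr fun k => ?_
    rw [hu, indGt]
    split_ifs <;> simp
  have f2 : (∑' q : ℤ × ℤ, if q.1 ≠ q.2 ∧ z < (q.1 : ℝ) ∧ z < (q.2 : ℝ) then
      oneP p ρ t q.1 * oneP p ρ t q.2 - h t q.1 q.2 else 0)
      = (∑' s, offDiag (fun k => indGt z k * u k) s).toReal
        - (∑' s, offDiag (indGt z) s * V s).toReal := by
    rw [ENNReal.tsum_toReal_eq fun s => ENNReal.ne_top_of_tsum_ne_top hS2 s,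
      ENNReal.tsum_toReal_eq fun s => ENNReal.ne_top_of_tsum_ne_top hD s,
      ← (ENNReal.summable_toReal hS2).tsum_sub (ENNReal.summable_toReal hD)]
    refine tsum_congr fun s => ?_
    rw [offDiag_mul]
    by_cases hs : s.1 = s.2
    · simp [offDiag, hs]
    · have hV : h t s.1 s.2 = (V s).toReal :=
        correlation_eq_pairSemi hsum hp0 hsym hρ01 h0 hbdd hderiv ht hs
      rw [hV, hu, hu]
      simp only [offDiag, hs, indGt]
      by_cases h1 : z < (s.1 : ℝ) <;> by_cases h2 : z < (s.2 : ℝ) <;> simp [h1, h2, hs]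
  have e3 := congrArg ENNReal.toReal (e2.symm.trans e1)
  rw [ENNReal.toReal_add hS1 hS2, ENNReal.toReal_add hK hD] at e3
  rw [f1, f2]
  linarith

end Exclusion

/-- Domination of second moments by the full step (Lemma on stirring
domination): for any Bernoulli product initial law `ν` with densities `ρ`
vanishing right of `0` and the deterministic full-step profile `η(k)=1_{k≤0}`,
`∑_{k>z}(E_ν[η_t(k)])² + 𝒞_t(ν,z) ≤ ∑_{k>z}(E_η[η_t(k)])² + 𝒞_t(η,z)`.
Here one-point functions are given by duality through `oneP`, and the
two-point correlation functions `hρ` (for `ν`) and `hη` (for `η`) are the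
bounded solutions of the two-particle exclusion Kolmogorov equations with
initial data `ρ j * ρ k` and `η j * η k` respectively. -/
theorem stmt14 (p : ℤ → ℝ) (hp0 : ∀ i, 0 ≤ p i) (hsym : ∀ i, p (-i) = p i)
    (hsum : ∑' i : ℤ, p i = 1)
    (hirr : ∀ x : ℤ, ∃ n : ℕ, 0 < convPow p n x)
    (θ : ℝ) (hθ : 0 < θ)
    (hexp : Summable fun i : ℤ => Real.exp (θ * (i : ℝ)) * p i)
    (σ : ℝ) (hσ : 0 < σ) (hσ2 : σ ^ 2 = ∑' i : ℤ, (i : ℝ) ^ 2 * p i)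
    (ρ : ℤ → ℝ) (hρ01 : ∀ k, 0 ≤ ρ k ∧ ρ k ≤ 1) (hρpos : ∀ k : ℤ, 0 < k → ρ k = 0)
    (hρ : ℝ → ℤ → ℤ → ℝ)
    (hρ0 : ∀ j k : ℤ, j ≠ k → hρ 0 j k = ρ j * ρ k)
    (hρbdd : ∀ (t : ℝ) (j k : ℤ), 0 ≤ hρ t j k ∧ hρ t j k ≤ 1)
    (hρderiv : ∀ j k : ℤ, j ≠ k → ∀ t : ℝ, 0 ≤ t →
      HasDerivWithinAt (fun s => hρ s j k) (twoGen p (hρ t) j k) (Set.Ici 0) t)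
    (hη : ℝ → ℤ → ℤ → ℝ)
    (hη0 : ∀ j k : ℤ, j ≠ k →
      hη 0 j k = (if j ≤ 0 then (1:ℝ) else 0) * (if k ≤ 0 then (1:ℝ) else 0))
    (hηbdd : ∀ (t : ℝ) (j k : ℤ), 0 ≤ hη t j k ∧ hη t j k ≤ 1)
    (hηderiv : ∀ j k : ℤ, j ≠ k → ∀ t : ℝ, 0 ≤ t →
      HasDerivWithinAt (fun s => hη s j k) (twoGen p (hη t) j k) (Set.Ici 0) t)
    (t : ℝ) (ht : 0 ≤ t) (z : ℝ) :
    (∑' k : ℤ, if z < (k : ℝ) then (oneP p ρ t k) ^ 2 else 0)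
        + (∑' q : ℤ × ℤ, if q.1 ≠ q.2 ∧ z < (q.1 : ℝ) ∧ z < (q.2 : ℝ) then
            oneP p ρ t q.1 * oneP p ρ t q.2 - hρ t q.1 q.2 else 0)
      ≤ (∑' k : ℤ, if z < (k : ℝ) then
            (oneP p (fun j => if j ≤ 0 then (1:ℝ) else 0) t k) ^ 2 else 0)
        + (∑' q : ℤ × ℤ, if q.1 ≠ q.2 ∧ z < (q.1 : ℝ) ∧ z < (q.2 : ℝ) then
            oneP p (fun j => if j ≤ 0 then (1:ℝ) else 0) t q.1
              * oneP p (fun j => if j ≤ 0 then (1:ℝ) else 0) t q.2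
            - hη t q.1 q.2 else 0) := by
  set η : ℤ → ℝ := fun j => if j ≤ 0 then (1 : ℝ) else 0 with hηdef
  have hη01 : ∀ k, 0 ≤ η k ∧ η k ≤ 1 := fun k => by
    simp only [hηdef]; split_ifs <;> simp
  have hηpos : ∀ k : ℤ, 0 < k → η k = 0 := fun k hk => if_neg (not_le.2 hk)
  obtain ⟨-, eρ⟩ := eq_toReal_meanSubVar hsum hp0 hsym hθ hexp hρ01 hρpos hρ0 hρbdd hρderiv ht z
  obtain ⟨hfin, eη⟩ :=
    eq_toReal_meanSubVar hsum hp0 hsym hθ hexp hη01 hηpos hη0 hηbdd hηderiv ht z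
  rw [eρ, eη]
  refine ENNReal.toReal_mono hfin (meanSubVar_mono p t z fun k => ENNReal.ofReal_le_ofReal ?_)
  by_cases hk : k ≤ 0
  · simpa [hηdef, hk] using (hρ01 k).2
  · rw [hρpos k (not_le.1 hk)]
    exact (hη01 k).1
end

section
/- Let L = L(t) → ∞ with L = o(√(t/log t)), and set z = σ b_t^{(L)}(x + a_t^{(L)}) with a_t^{(L)} = log(L²/√(2π log L²)) and b_t^{(L)} = √(t/log L²). Then for the deterministic L-step configuration η_L(k)=1 iff -L ≤ k ≤ 0, the mean number of particles beyond z in the symmetric exclusion process, E_{η_L}[N_t] = ∑_{i=-L}^0 P_i(ξ_t > z), converges to e^{-x} as t → ∞. -/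
open MeasureTheory Filter
open scoped Topology ENNReal

/-- The characteristic function of a symmetric step distribution `p`. -/
noncomputable def cosTransform (p : ℤ → ℝ) (θ : ℝ) : ℝ := ∑' m : ℤ, p m * Real.cos (m * θ)

lemma convPow_nonneg {p : ℤ → ℝ} (hp0 : ∀ i, 0 ≤ p i) (n : ℕ) (x : ℤ) : 0 ≤ convPow p n x := by
  induction n generalizing x with
  | zero => simp only [convPow]; split_ifs <;> norm_num
  | succ n ih => exact tsum_nonneg fun y => mul_nonneg (ih y) (hp0 _)

lemma hasSum_convPow {p : ℤ → ℝ} (hp0 : ∀ i, 0 ≤ p i) (hp : HasSum p 1) (n : ℕ) :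
    HasSum (convPow p n) 1 := by
  induction n with
  | zero => simpa [convPow] using hasSum_ite_eq (0 : ℤ) (1 : ℝ)
  | succ n ih =>
    have hmul : HasSum (fun w : ℤ × ℤ => convPow p n w.1 * p w.2) 1 := by
      have := ih.mul hp (ih.summable.mul_of_nonneg hp.summable (convPow_nonneg hp0 n) hp0)
      simpa using this
    have hshear := ((Equiv.prodComm ℤ ℤ).trans
      (Equiv.prodShear (Equiv.refl ℤ) (fun y : ℤ => Equiv.subRight y))).hasSum_iff.2 hmul
    exact hshear.prod_fiberwise fun x => (hshear.summable.prod_factor x).hasSum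

section

variable {p : ℤ → ℝ}

lemma abs_mul_cos_le (hp0 : ∀ i, 0 ≤ p i) (m : ℤ) (y : ℝ) : |p m * Real.cos y| ≤ p m := by
  rw [abs_mul, abs_of_nonneg (hp0 m)]
  exact mul_le_of_le_one_right (hp0 m) (Real.abs_cos_le_one _)

lemma summable_mul_cos (hp0 : ∀ i, 0 ≤ p i) (hp : HasSum p 1) (θ : ℝ) :
    Summable fun m : ℤ => p m * Real.cos (m * θ) :=
  Summable.of_norm_bounded hp.summable fun m => abs_mul_cos_le hp0 m _

lemma summable_mul_sin (hp0 : ∀ i, 0 ≤ p i) (hp : HasSum p 1) (θ : ℝ) :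
    Summable fun m : ℤ => p m * Real.sin (m * θ) := by
  refine Summable.of_norm_bounded hp.summable fun m => ?_
  rw [Real.norm_eq_abs, abs_mul, abs_of_nonneg (hp0 m)]
  exact mul_le_of_le_one_right (hp0 m) (Real.abs_sin_le_one _)

lemma continuous_cosTransform (hp0 : ∀ i, 0 ≤ p i) (hp : HasSum p 1) :
    Continuous (cosTransform p) :=
  continuous_tsum (fun m => by fun_prop) hp.summable fun m θ => abs_mul_cos_le hp0 m _

lemma abs_cosTransform_le_one (hp0 : ∀ i, 0 ≤ p i) (hp : HasSum p 1) (θ : ℝ) :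
    |cosTransform p θ| ≤ 1 := by
  have := tsum_of_norm_bounded (f := fun m : ℤ => p m * Real.cos (m * θ)) hp
    fun m => abs_mul_cos_le hp0 m _
  simpa [cosTransform] using this

lemma hasSum_one_sub_cosTransform (hp0 : ∀ i, 0 ≤ p i) (hp : HasSum p 1) (θ : ℝ) :
    HasSum (fun m : ℤ => p m * (1 - Real.cos (m * θ))) (1 - cosTransform p θ) := by
  simpa [mul_sub, cosTransform] using hp.sub (summable_mul_cos hp0 hp θ).hasSum

lemma hasSum_mul_cos_sub (hp0 : ∀ i, 0 ≤ p i) (hsym : ∀ i, p (-i) = p i) (hp : HasSum p 1)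
    (k : ℤ) (θ : ℝ) :
    HasSum (fun y : ℤ => p (k - y) * Real.cos (y * θ)) (cosTransform p θ * Real.cos (k * θ)) := by
  have hsin : ∑' m : ℤ, p m * Real.sin (m * θ) = 0 := by
    have h := (Equiv.neg ℤ).tsum_eq fun m : ℤ => p m * Real.sin (m * θ)
    simp only [Equiv.neg_apply, hsym, Int.cast_neg, neg_mul, Real.sin_neg, mul_neg, tsum_neg] at h
    linarith
  have h := ((summable_mul_cos hp0 hp θ).hasSum.mul_right (Real.cos (k * θ))).add
    ((summable_mul_sin hp0 hp θ).hasSum.mul_right (Real.sin (k * θ)))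
  rw [hsin, zero_mul, add_zero] at h
  refine ((Equiv.subLeft k).hasSum_iff.2 h).congr_fun fun y => ?_
  have : (y : ℝ) * θ = k * θ - ((k - y : ℤ) : ℝ) * θ := by push_cast; ring
  simp only [Function.comp, Equiv.subLeft_apply]
  rw [this, Real.cos_sub]
  ring

lemma one_sub_cos_add_le (a b : ℝ) :
    1 - Real.cos (a + b) ≤ 2 * (1 - Real.cos a) + 2 * (1 - Real.cos b) := by
  rw [Real.cos_add]
  nlinarith [Real.sin_sq_add_cos_sq a, Real.sin_sq_add_cos_sq b,
    sq_nonneg (Real.sin a - Real.sin b), sq_nonneg (Real.cos a + Real.cos b - 2),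
    Real.cos_le_one a, Real.cos_le_one b]

lemma exists_mul_one_sub_cos_le (hp0 : ∀ i, 0 ≤ p i) (hp : HasSum p 1) {n : ℕ} {x : ℤ}
    (hx : 0 < convPow p n x) :
    ∃ c > 0, ∀ θ : ℝ, c * (1 - Real.cos (x * θ)) ≤ 1 - cosTransform p θ := by
  induction n generalizing x with
  | zero =>
    have hx0 : x = 0 := by
      by_contra h
      simp [convPow, h] at hx
    exact ⟨1, one_pos, fun θ => by
      simpa [hx0] using (abs_le.1 (abs_cosTransform_le_one hp0 hp θ)).2⟩
  | succ n ih =>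
    obtain ⟨y, hy⟩ : ∃ y, convPow p n y * p (x - y) ≠ 0 := by
      by_contra! h
      simp [convPow, h] at hx
    have hy1 : 0 < convPow p n y := (convPow_nonneg hp0 n y).lt_of_ne' (left_ne_zero_of_mul hy)
    have hy2 : 0 < p (x - y) := (hp0 _).lt_of_ne' (right_ne_zero_of_mul hy)
    obtain ⟨c, hc, hcθ⟩ := ih hy1
    refine ⟨min c (p (x - y)) / 4, by positivity, fun θ => ?_⟩
    have h1 : p (x - y) * (1 - Real.cos ((x - y : ℤ) * θ)) ≤ 1 - cosTransform p θ :=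
      le_hasSum (hasSum_one_sub_cosTransform hp0 hp θ) (x - y) fun m _ =>
        mul_nonneg (hp0 m) (sub_nonneg.2 (Real.cos_le_one _))
    have h2 := hcθ θ
    have h3 := one_sub_cos_add_le (y * θ) ((x - y : ℤ) * θ)
    rw [show (y : ℝ) * θ + ((x - y : ℤ) : ℝ) * θ = x * θ by push_cast; ring] at h3
    have h4 := mul_le_mul_of_nonneg_right (min_le_left c (p (x - y)))
      (sub_nonneg.2 (Real.cos_le_one (y * θ)))
    have h5 := mul_le_mul_of_nonneg_right (min_le_right c (p (x - y)))
      (sub_nonneg.2 (Real.cos_le_one ((x - y : ℤ) * θ)))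
    have h6 : 0 < min c (p (x - y)) := by positivity
    nlinarith

lemma exists_mul_sq_le_one_sub_cosTransform (hp0 : ∀ i, 0 ≤ p i) (hp : HasSum p 1)
    (hirr : ∀ x : ℤ, ∃ n : ℕ, 0 < convPow p n x) :
    ∃ c > 0, ∀ θ : ℝ, |θ| ≤ Real.pi → c * θ ^ 2 ≤ 1 - cosTransform p θ := by
  obtain ⟨n, hn⟩ := hirr 1
  obtain ⟨c, hc, hcθ⟩ := exists_mul_one_sub_cos_le hp0 hp hn
  refine ⟨c * (2 / Real.pi ^ 2), by positivity, fun θ hθ => ?_⟩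
  have h1 := hcθ θ
  have h2 := Real.cos_le_one_sub_mul_cos_sq hθ
  rw [Int.cast_one, one_mul] at h1
  nlinarith

lemma integral_cos_int_mul (k : ℤ) :
    ∫ θ in -Real.pi..Real.pi, Real.cos (k * θ) = if k = 0 then 2 * Real.pi else 0 := by
  split_ifs with hk
  · simp [hk]; ring
  · have hk' : (k : ℝ) ≠ 0 := by exact_mod_cast hk
    rw [intervalIntegral.integral_comp_mul_left (fun y => Real.cos y) hk']
    simp [Real.sin_int_mul_pi]

lemma convPow_eq_integral (hp0 : ∀ i, 0 ≤ p i) (hsym : ∀ i, p (-i) = p i) (hp : HasSum p 1)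
    (n : ℕ) (k : ℤ) :
    convPow p n k = (2 * Real.pi)⁻¹ *
      ∫ θ in -Real.pi..Real.pi, cosTransform p θ ^ n * Real.cos (k * θ) := by
  have hpi := Real.pi_pos
  induction n generalizing k with
  | zero =>
    simp only [pow_zero, one_mul, integral_cos_int_mul, convPow]
    split_ifs <;> field_simp; simp
  | succ n ih =>
    have hcont := continuous_cosTransform hp0 hp
    have hshift : HasSum (fun y : ℤ => p (k - y)) 1 := (Equiv.subLeft k).hasSum_iff.2 hp
    have hbound (θ : ℝ) : |cosTransform p θ ^ n| ≤ 1 := by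
      rw [abs_pow]; exact pow_le_one₀ (abs_nonneg _) (abs_cosTransform_le_one hp0 hp θ)
    have key := intervalIntegral.hasSum_integral_of_dominated_convergence
      (μ := volume) (a := -Real.pi) (b := Real.pi)
      (F := fun (y : ℤ) θ => cosTransform p θ ^ n * (p (k - y) * Real.cos (y * θ)))
      (f := fun θ => cosTransform p θ ^ n * (cosTransform p θ * Real.cos (k * θ)))
      (fun y _ => p (k - y))
      (fun y => Continuous.aestronglyMeasurable (by fun_prop))
      (fun y => ae_of_all _ fun θ _ => by
        rw [Real.norm_eq_abs, abs_mul]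
        exact (mul_le_of_le_one_left (abs_nonneg _) (hbound θ)).trans
          (abs_mul_cos_le hp0 _ _))
      (ae_of_all _ fun θ _ => hshift.summable)
      (by simp)
      (ae_of_all _ fun θ _ => (hasSum_mul_cos_sub hp0 hsym hp k θ).mul_left _)
    have key' := key.mul_left (2 * Real.pi)⁻¹
    simp only [convPow, pow_succ, mul_assoc]
    rw [← key'.tsum_eq]
    refine tsum_congr fun y => ?_
    rw [ih, mul_assoc, ← intervalIntegral.integral_mul_const]
    simp only [mul_assoc, mul_comm (p (k - y))]

lemma hasSum_exp_mul_pow (t r : ℝ) :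
    HasSum (fun n : ℕ => Real.exp (-t) * t ^ n / n.factorial * r ^ n)
      (Real.exp (-(t * (1 - r)))) := by
  have h := (NormedSpace.expSeries_div_hasSum_exp (t * r : ℝ)).mul_left (Real.exp (-t))
  rw [← Real.exp_eq_exp_ℝ, ← Real.exp_add, show -t + t * r = -(t * (1 - r)) by ring] at h
  refine h.congr_fun fun n => ?_
  rw [mul_pow]
  ring

lemma hasSum_tsum_mul_convPow (hp0 : ∀ i, 0 ≤ p i) (hp : HasSum p 1) {w : ℕ → ℝ}
    (hw0 : ∀ n, 0 ≤ w n) (hw : HasSum w 1) :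
    HasSum (fun x : ℤ => ∑' n, w n * convPow p n x) 1 := by
  have hsummable : Summable fun v : ℕ × ℤ => w v.1 * convPow p v.1 v.2 := by
    refine (summable_prod_of_nonneg fun v => mul_nonneg (hw0 _) (convPow_nonneg hp0 _ _)).2
      ⟨fun n => (hasSum_convPow hp0 hp n).summable.mul_left (w n), ?_⟩
    simpa [tsum_mul_left, (hasSum_convPow hp0 hp _).tsum_eq] using hw.summable
  have h2 := hsummable.hasSum.prod_fiberwise fun n => (hasSum_convPow hp0 hp n).mul_left (w n)
  simp only [mul_one] at h2
  have h3 := (Equiv.prodComm ℤ ℕ).hasSum_iff.2 hsummable.hasSum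
  rw [h2.unique hw] at h3
  exact h3.prod_fiberwise fun x => (h3.summable.prod_factor x).hasSum

lemma hasSum_ctPMF (hp0 : ∀ i, 0 ≤ p i) (hp : HasSum p 1) {t : ℝ} (ht : 0 ≤ t) :
    HasSum (ctPMF p t) 1 :=
  hasSum_tsum_mul_convPow hp0 hp (fun n => by positivity)
    (by simpa using hasSum_exp_mul_pow t 1)

lemma ctPMF_nonneg (hp0 : ∀ i, 0 ≤ p i) {t : ℝ} (ht : 0 ≤ t) (k : ℤ) : 0 ≤ ctPMF p t k :=
  tsum_nonneg fun n => mul_nonneg (by positivity) (convPow_nonneg hp0 n k)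

lemma ctPMF_eq_integral (hp0 : ∀ i, 0 ≤ p i) (hsym : ∀ i, p (-i) = p i) (hp : HasSum p 1)
    {t : ℝ} (ht : 0 ≤ t) (k : ℤ) :
    ctPMF p t k = (2 * Real.pi)⁻¹ *
      ∫ θ in -Real.pi..Real.pi, Real.exp (-(t * (1 - cosTransform p θ))) * Real.cos (k * θ) := by
  have hcont := continuous_cosTransform hp0 hp
  have h1 : Summable fun n : ℕ => Real.exp (-t) * t ^ n / n.factorial := by
    simpa using (hasSum_exp_mul_pow t 1).summable
  have key := intervalIntegral.hasSum_integral_of_dominated_convergence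
    (μ := volume) (a := -Real.pi) (b := Real.pi)
    (F := fun (n : ℕ) θ => Real.exp (-t) * t ^ n / n.factorial * cosTransform p θ ^ n
      * Real.cos (k * θ))
    (f := fun θ => Real.exp (-(t * (1 - cosTransform p θ))) * Real.cos (k * θ))
    (fun n _ => Real.exp (-t) * t ^ n / n.factorial)
    (fun n => Continuous.aestronglyMeasurable (by fun_prop))
    (fun n => ae_of_all _ fun θ _ => by
      have hw : 0 ≤ Real.exp (-t) * t ^ n / n.factorial := by positivity
      rw [Real.norm_eq_abs, abs_mul, abs_mul, abs_of_nonneg hw, abs_pow, mul_assoc]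
      exact mul_le_of_le_one_right hw (mul_le_one₀
        (pow_le_one₀ (abs_nonneg _) (abs_cosTransform_le_one hp0 hp θ)) (abs_nonneg _)
        (Real.abs_cos_le_one _)))
    (ae_of_all _ fun θ _ => h1)
    (by simp)
    (ae_of_all _ fun θ _ => (hasSum_exp_mul_pow t _).mul_right _)
  rw [← (key.mul_left (2 * Real.pi)⁻¹).tsum_eq]
  refine tsum_congr fun n => ?_
  rw [convPow_eq_integral hp0 hsym hp, mul_left_comm, ← intervalIntegral.integral_const_mul]
  simp only [mul_assoc]

lemma ctPMF_neg (hp0 : ∀ i, 0 ≤ p i) (hsym : ∀ i, p (-i) = p i) (hp : HasSum p 1)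
    {t : ℝ} (ht : 0 ≤ t) (k : ℤ) : ctPMF p t (-k) = ctPMF p t k := by
  simp [ctPMF_eq_integral hp0 hsym hp ht]

end

section

variable {p : ℤ → ℝ}

lemma abs_one_sub_cos_sub_sq_le (y : ℝ) : |1 - Real.cos y - y ^ 2 / 2| ≤ y ^ 4 := by
  rcases le_total |y| 1 with h | h
  · have h1 := Real.cos_bound h
    rw [abs_sub_comm, show |y| ^ 4 = y ^ 4 from (by decide : Even 4).pow_abs y] at h1
    rw [show 1 - Real.cos y - y ^ 2 / 2 = 1 - y ^ 2 / 2 - Real.cos y by ring]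
    exact h1.trans (by nlinarith [pow_nonneg (sq_nonneg y) 2])
  · have h1 := Real.one_sub_sq_div_two_le_cos (x := y)
    have h2 : 1 ≤ y ^ 2 := by rwa [one_le_sq_iff_one_le_abs]
    rw [abs_le]
    constructor <;> nlinarith [Real.cos_le_one y, Real.neg_one_le_cos y]

lemma summable_pow_four_mul (hp0 : ∀ i, 0 ≤ p i) (hsym : ∀ i, p (-i) = p i) {θ : ℝ} (hθ : 0 < θ)
    (hexp : Summable fun i : ℤ => Real.exp (θ * (i : ℝ)) * p i) :
    Summable fun i : ℤ => (i : ℝ) ^ 4 * p i := by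
  have hneg : Summable fun i : ℤ => Real.exp (θ * -(i : ℝ)) * p i := by
    refine ((Equiv.neg ℤ).summable_iff.2 hexp).congr fun i => ?_
    simp [hsym]
  refine Summable.of_nonneg_of_le (fun i => mul_nonneg (by positivity) (hp0 i)) (fun i => ?_)
    ((hexp.add hneg).mul_left (24 / θ ^ 4))
  rw [← add_mul, ← mul_assoc]
  refine mul_le_mul_of_nonneg_right ?_ (hp0 i)
  have key (y : ℝ) (hy : 0 ≤ y) : y ^ 4 ≤ 24 / θ ^ 4 * Real.exp (θ * y) := by
    have h := Real.pow_div_factorial_le_exp (x := θ * y) (mul_nonneg hθ.le hy) 4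
    rw [mul_pow] at h
    norm_num [Nat.factorial] at h
    rw [div_mul_eq_mul_div, le_div_iff₀ (by positivity)]
    linarith
  have hpos : 0 ≤ 24 / θ ^ 4 := by positivity
  rcases le_total 0 (i : ℝ) with h | h
  · refine (key _ h).trans (mul_le_mul_of_nonneg_left ?_ hpos)
    linarith [Real.exp_pos (θ * -(i : ℝ))]
  · rw [show (i : ℝ) ^ 4 = (-(i : ℝ)) ^ 4 by ring]
    refine (key _ (neg_nonneg.2 h)).trans (mul_le_mul_of_nonneg_left ?_ hpos)
    linarith [Real.exp_pos (θ * (i : ℝ))]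

lemma abs_one_sub_cosTransform_sub_le (hp0 : ∀ i, 0 ≤ p i) (hp : HasSum p 1)
    (h4 : Summable fun i : ℤ => (i : ℝ) ^ 4 * p i) (θ : ℝ) :
    |1 - cosTransform p θ - (∑' i : ℤ, (i : ℝ) ^ 2 * p i) * θ ^ 2 / 2| ≤
      (∑' i : ℤ, (i : ℝ) ^ 4 * p i) * θ ^ 4 := by
  have h2 : Summable fun i : ℤ => (i : ℝ) ^ 2 * p i := by
    refine Summable.of_nonneg_of_le (fun i => mul_nonneg (by positivity) (hp0 i)) (fun i => ?_)
      (h4.add hp.summable)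
    nlinarith [mul_nonneg (sq_nonneg ((i : ℝ) ^ 2 - 1)) (hp0 i), hp0 i,
      mul_nonneg (sq_nonneg (i : ℝ)) (hp0 i)]
  have hdiff := (hasSum_one_sub_cosTransform hp0 hp θ).sub (h2.hasSum.mul_right (θ ^ 2 / 2))
  rw [← mul_div_assoc] at hdiff
  rw [← hdiff.tsum_eq]
  refine tsum_of_norm_bounded (f := fun i : ℤ => p i * (1 - Real.cos (i * θ)) -
    (i : ℝ) ^ 2 * p i * (θ ^ 2 / 2)) (h4.hasSum.mul_right (θ ^ 4)) fun i => ?_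
  rw [show p i * (1 - Real.cos (i * θ)) - (i : ℝ) ^ 2 * p i * (θ ^ 2 / 2) =
    p i * (1 - Real.cos (i * θ) - (i * θ) ^ 2 / 2) by ring, Real.norm_eq_abs, abs_mul,
    abs_of_nonneg (hp0 i)]
  calc p i * |1 - Real.cos (i * θ) - (i * θ) ^ 2 / 2| ≤ p i * (i * θ) ^ 4 :=
        mul_le_mul_of_nonneg_left (abs_one_sub_cos_sub_sq_le _) (hp0 i)
    _ = _ := by ring

lemma integral_exp_neg_mul_sq_mul_cos {b : ℝ} (hb : 0 < b) (k : ℝ) :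
    ∫ θ : ℝ, Real.exp (-b * θ ^ 2) * Real.cos (k * θ) =
      √(Real.pi / b) * Real.exp (-k ^ 2 / (4 * b)) := by
  have h := fourierIntegral_gaussian (b := (b : ℂ)) (by simpa using hb) (k : ℂ)
  have hint : Integrable fun x : ℝ =>
      Complex.exp (Complex.I * k * x) * Complex.exp (-(b : ℂ) * x ^ 2) := by
    have := integrable_cexp_quadratic (b := (b : ℂ)) (by simpa using hb) (Complex.I * k) 0
    refine this.congr (ae_of_all _ fun x => ?_)
    simp only [← Complex.exp_add]
    ring_nf
  have hre := integral_re hint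
  have hrhs : ((Real.pi : ℂ) / b) ^ (1 / 2 : ℂ) * Complex.exp (-(k : ℂ) ^ 2 / (4 * b)) =
      ((√(Real.pi / b) * Real.exp (-k ^ 2 / (4 * b)) : ℝ) : ℂ) := by
    rw [Real.sqrt_eq_rpow, Complex.ofReal_mul, Complex.ofReal_cpow (by positivity)]
    push_cast
    rfl
  rw [h, hrhs] at hre
  refine Eq.trans (integral_congr_ae (ae_of_all _ fun θ => ?_)) (hre.trans (Complex.ofReal_re _))
  have h1 : Complex.exp (-(b : ℂ) * θ ^ 2) = ((Real.exp (-b * θ ^ 2) : ℝ) : ℂ) := by push_cast; rfl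
  have h2 : Complex.I * k * θ = ((k * θ : ℝ) : ℂ) * Complex.I := by push_cast; ring
  simp only [h1, h2, RCLike.re_to_complex, Complex.re_mul_ofReal, Complex.exp_ofReal_mul_I_re]
  ring

lemma abs_exp_neg_sub_exp_neg_le {a b m : ℝ} (ha : m ≤ a) (hb : m ≤ b) :
    |Real.exp (-a) - Real.exp (-b)| ≤ |a - b| * Real.exp (-m) := by
  wlog hab : a ≤ b generalizing a b
  · rw [abs_sub_comm, abs_sub_comm a]
    exact this hb ha (le_of_not_ge hab)
  have h1 : Real.exp (-b) = Real.exp (-a) * Real.exp (-(b - a)) := by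
    rw [← Real.exp_add]; ring_nf
  have h2 := Real.add_one_le_exp (-(b - a))
  have h3 : Real.exp (-a) ≤ Real.exp (-m) := Real.exp_le_exp.2 (by linarith)
  have h4 : Real.exp (-b) ≤ Real.exp (-a) := Real.exp_le_exp.2 (by linarith)
  rw [abs_of_nonneg (by linarith), abs_of_nonpos (by linarith), h1]
  nlinarith [Real.exp_pos (-a)]

lemma sq_mul_exp_neg_le {c : ℝ} (hc : 0 < c) {y : ℝ} (hy : 0 ≤ y) :
    y ^ 2 * Real.exp (-(c * y)) ≤ 8 / c ^ 2 * Real.exp (-(c * y / 2)) := by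
  have h := Real.pow_div_factorial_le_exp (x := c * y / 2) (by positivity) 2
  have h1 : Real.exp (-(c * y)) = Real.exp (-(c * y / 2)) * Real.exp (-(c * y / 2)) := by
    rw [← Real.exp_add]; ring_nf
  have h2 : Real.exp (c * y / 2) * Real.exp (-(c * y / 2)) = 1 := by
    rw [← Real.exp_add]; simp
  have h3 : y ^ 2 ≤ 8 / c ^ 2 * Real.exp (c * y / 2) := by
    rw [div_mul_eq_mul_div, le_div_iff₀ (by positivity)]
    norm_num [Nat.factorial] at h
    nlinarith
  calc y ^ 2 * Real.exp (-(c * y))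
      ≤ 8 / c ^ 2 * Real.exp (c * y / 2) * Real.exp (-(c * y)) := by gcongr
    _ = 8 / c ^ 2 * (Real.exp (c * y / 2) * Real.exp (-(c * y / 2))) *
        Real.exp (-(c * y / 2)) := by rw [h1]; ring
    _ = _ := by rw [h2, mul_one]

/-- The local central limit theorem for the continuous-time walk, with a rate. -/
lemma exists_abs_ctPMF_sub_le (hp0 : ∀ i, 0 ≤ p i) (hsym : ∀ i, p (-i) = p i) (hp : HasSum p 1)
    (hirr : ∀ x : ℤ, ∃ n : ℕ, 0 < convPow p n x)
    (h4 : Summable fun i : ℤ => (i : ℝ) ^ 4 * p i)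
    {σ : ℝ} (hσ : 0 < σ) (hσ2 : σ ^ 2 = ∑' i : ℤ, (i : ℝ) ^ 2 * p i) :
    ∃ C > 0, ∀ t : ℝ, 1 ≤ t → ∀ k : ℤ,
      |ctPMF p t k - √((2 * σ ^ 2 * t)⁻¹ / Real.pi) *
        Real.exp (-((2 * σ ^ 2 * t)⁻¹ * (k : ℝ) ^ 2))| ≤ C / (t * √t) := by
  obtain ⟨c₀, hc₀, hlow⟩ := exists_mul_sq_le_one_sub_cosTransform hp0 hp hirr
  have hpi := Real.pi_pos
  set c := min c₀ (σ ^ 2 / 2) with hc_def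
  have hc : 0 < c := by positivity
  set M := max 1 (∑' i : ℤ, (i : ℝ) ^ 4 * p i) with hM_def
  have hM : 0 < M := by positivity
  refine ⟨(2 * Real.pi)⁻¹ * (M * (8 / c ^ 2) * √(Real.pi / (c / 2))), by positivity,
    fun t ht k => ?_⟩
  have ht0 : 0 < t := by linarith
  have hcont := continuous_cosTransform hp0 hp
  set F : ℝ → ℝ := (Set.Ioc (-Real.pi) Real.pi).indicator
    fun θ => Real.exp (-(t * (1 - cosTransform p θ))) * Real.cos (k * θ) with hF
  set G : ℝ → ℝ := fun θ => Real.exp (-(σ ^ 2 * t / 2) * θ ^ 2) * Real.cos (k * θ) with hG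
  have hFint : Integrable F := by
    rw [hF, integrable_indicator_iff measurableSet_Ioc]
    exact (Continuous.integrableOn_Icc (by fun_prop)).mono_set Set.Ioc_subset_Icc_self
  have hGint : Integrable G := by
    refine (integrable_exp_neg_mul_sq (b := σ ^ 2 * t / 2) (by positivity)).mono'
      (Continuous.aestronglyMeasurable (by fun_prop)) (ae_of_all _ fun θ => ?_)
    rw [Real.norm_eq_abs, abs_mul, Real.abs_exp]
    exact mul_le_of_le_one_right (Real.exp_pos _).le (Real.abs_cos_le_one _)
  have hPF : ctPMF p t k = (2 * Real.pi)⁻¹ * ∫ θ, F θ := by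
    rw [ctPMF_eq_integral hp0 hsym hp ht0.le, intervalIntegral.integral_of_le (by linarith), hF,
      integral_indicator measurableSet_Ioc]
  have hgG : √((2 * σ ^ 2 * t)⁻¹ / Real.pi) * Real.exp (-((2 * σ ^ 2 * t)⁻¹ * (k : ℝ) ^ 2)) =
      (2 * Real.pi)⁻¹ * ∫ θ, G θ := by
    rw [hG, integral_exp_neg_mul_sq_mul_cos (by positivity), ← mul_assoc]
    congr 1
    · rw [Real.sqrt_eq_iff_mul_self_eq_of_pos (by positivity), mul_mul_mul_comm,
        Real.mul_self_sqrt (by positivity)]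
      field_simp
    · congr 1; field_simp; ring
  have hbound (θ : ℝ) : ‖F θ - G θ‖ ≤ M * (8 / c ^ 2) / t * Real.exp (-(c / 2 * t) * θ ^ 2) := by
    have hcos := Real.abs_cos_le_one (k * θ)
    have hcσ : c * (t * θ ^ 2) ≤ σ ^ 2 * t / 2 * θ ^ 2 := by
      have := mul_le_mul_of_nonneg_right (min_le_right c₀ (σ ^ 2 / 2))
        (by positivity : 0 ≤ t * θ ^ 2)
      linarith
    have h1 : ‖F θ - G θ‖ ≤ M * (t * θ ^ 4) * Real.exp (-(c * (t * θ ^ 2))) := by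
      by_cases hθ : θ ∈ Set.Ioc (-Real.pi) Real.pi
      · have h2 := abs_exp_neg_sub_exp_neg_le (a := t * (1 - cosTransform p θ))
          (b := σ ^ 2 * t / 2 * θ ^ 2) (m := c * (t * θ ^ 2)) ?_ hcσ
        · have h3 : |t * (1 - cosTransform p θ) - σ ^ 2 * t / 2 * θ ^ 2| ≤ M * (t * θ ^ 4) := by
            rw [show t * (1 - cosTransform p θ) - σ ^ 2 * t / 2 * θ ^ 2 =
              t * (1 - cosTransform p θ - σ ^ 2 * θ ^ 2 / 2) by ring, abs_mul, abs_of_pos ht0, hσ2]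
            have h5 := abs_one_sub_cosTransform_sub_le hp0 hp h4 θ
            have h6 := mul_le_mul_of_nonneg_right (le_max_right 1 (∑' i : ℤ, (i : ℝ) ^ 4 * p i))
              (by positivity : 0 ≤ θ ^ 4)
            calc _ ≤ t * (M * θ ^ 4) := mul_le_mul_of_nonneg_left (h5.trans h6) ht0.le
              _ = _ := by ring
          rw [hF, Set.indicator_of_mem hθ, hG]
          simp only [neg_mul, ← sub_mul]
          rw [Real.norm_eq_abs, abs_mul]
          refine (mul_le_of_le_one_right (abs_nonneg _) hcos).trans (h2.trans ?_)
          gcongr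
        · have h5 := hlow θ (abs_le.2 ⟨hθ.1.le, hθ.2⟩)
          have h6 : c * θ ^ 2 ≤ c₀ * θ ^ 2 := by gcongr; exact min_le_left _ _
          nlinarith
      · have hθ1 : 1 ≤ θ ^ 2 := by
          rw [Set.mem_Ioc, not_and_or, not_lt, not_le] at hθ
          have := Real.pi_gt_three
          rcases hθ with h | h <;> nlinarith
        have hθ4 : 1 ≤ M * (t * θ ^ 4) := by
          have hM1 : 1 ≤ M := le_max_left _ _
          have : 1 ≤ θ ^ 4 := by nlinarith
          exact one_le_mul_of_one_le_of_one_le hM1 (one_le_mul_of_one_le_of_one_le ht this)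
        rw [hF, Set.indicator_of_notMem hθ, zero_sub, norm_neg, hG, Real.norm_eq_abs, abs_mul,
          Real.abs_exp]
        refine (mul_le_of_le_one_right (Real.exp_pos _).le hcos).trans ?_
        refine le_trans ?_ (le_mul_of_one_le_left (Real.exp_pos _).le hθ4)
        exact Real.exp_le_exp.2 (by linarith)
    refine h1.trans ?_
    have h2 := sq_mul_exp_neg_le hc (by positivity : 0 ≤ t * θ ^ 2)
    calc M * (t * θ ^ 4) * Real.exp (-(c * (t * θ ^ 2)))
        = M / t * ((t * θ ^ 2) ^ 2 * Real.exp (-(c * (t * θ ^ 2)))) := by field_simp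
      _ ≤ M / t * (8 / c ^ 2 * Real.exp (-(c * (t * θ ^ 2) / 2))) := by gcongr
      _ = _ := by ring_nf
  have hdom : Integrable fun θ : ℝ =>
      M * (8 / c ^ 2) / t * Real.exp (-(c / 2 * t) * θ ^ 2) :=
    (integrable_exp_neg_mul_sq (by positivity)).const_mul _
  have hfinal := norm_integral_le_of_norm_le hdom (ae_of_all _ hbound)
  rw [integral_sub hFint hGint, integral_const_mul, integral_gaussian] at hfinal
  rw [hPF, hgG, ← mul_sub, abs_mul, abs_of_pos (by positivity), mul_div_assoc]
  refine mul_le_mul_of_nonneg_left (hfinal.trans_eq ?_) (by positivity)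
  rw [← div_div, Real.sqrt_div' _ ht0.le]
  field_simp

end

lemma tendsto_exp_neg_mul_sq {a : ℝ} (ha : 0 < a) :
    Tendsto (fun x : ℝ => Real.exp (-a * x ^ 2)) atTop (𝓝 0) :=
  Real.tendsto_exp_atBot.comp
    ((tendsto_pow_atTop two_ne_zero).const_mul_atTop_of_neg (by linarith))

lemma hasDerivAt_exp_neg_mul_sq (a x : ℝ) :
    HasDerivAt (fun x : ℝ => Real.exp (-a * x ^ 2)) (-(2 * a * x * Real.exp (-a * x ^ 2))) x := by
  convert ((hasDerivAt_pow 2 x).const_mul (-a)).exp using 1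
  simp
  ring

lemma integral_Ioi_exp_neg_mul_sq_le {a z : ℝ} (ha : 0 < a) (hz : 0 < z) :
    ∫ x in Set.Ioi z, Real.exp (-a * x ^ 2) ≤ Real.exp (-a * z ^ 2) / (2 * a * z) := by
  have hint := (integrable_mul_exp_neg_mul_sq ha).integrableOn (s := Set.Ioi z)
  have h1 : ∫ x in Set.Ioi z, x * Real.exp (-a * x ^ 2) = Real.exp (-a * z ^ 2) / (2 * a) := by
    have h := integral_Ioi_of_hasDerivAt_of_tendsto' (a := z)
      (fun x _ => (hasDerivAt_exp_neg_mul_sq a x).div_const (-(2 * a)))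
      (hint.congr_fun (fun x _ => by field_simp) measurableSet_Ioi)
      ((tendsto_exp_neg_mul_sq ha).div_const (-(2 * a)))
    rw [zero_div, zero_sub, div_neg, neg_neg] at h
    rw [← h]
    exact integral_congr_ae (ae_of_all _ fun x => by field_simp)
  calc ∫ x in Set.Ioi z, Real.exp (-a * x ^ 2)
      ≤ ∫ x in Set.Ioi z, z⁻¹ * (x * Real.exp (-a * x ^ 2)) := by
        refine setIntegral_mono_on (integrable_exp_neg_mul_sq ha).integrableOn (hint.const_mul _)
          measurableSet_Ioi fun x hx => ?_
        rw [← mul_assoc]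
        refine le_mul_of_one_le_left (Real.exp_pos _).le ?_
        rw [inv_mul_eq_div, one_le_div hz]
        exact (Set.mem_Ioi.1 hx).le
    _ = _ := by rw [integral_const_mul, h1]; field_simp

lemma le_integral_Ioi_exp_neg_mul_sq {a z : ℝ} (ha : 0 < a) (hz : 0 < z) :
    Real.exp (-a * z ^ 2) / (2 * a * z) / (1 + 1 / (2 * a * z ^ 2)) ≤
      ∫ x in Set.Ioi z, Real.exp (-a * x ^ 2) := by
  have hderiv (x : ℝ) (hx : x ∈ Set.Ici z) :
      HasDerivAt (fun x : ℝ => -(Real.exp (-a * x ^ 2) / (2 * a * x)))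
        (Real.exp (-a * x ^ 2) * (1 + 1 / (2 * a * x ^ 2))) x := by
    have hx0 : 0 < x := hz.trans_le hx
    have h := ((hasDerivAt_exp_neg_mul_sq a x).fun_div ((hasDerivAt_id' x).const_mul (2 * a))
      (by positivity)).fun_neg
    refine h.congr_deriv ?_
    field_simp
    ring
  have htend : Tendsto (fun x : ℝ => -(Real.exp (-a * x ^ 2) / (2 * a * x))) atTop (𝓝 0) := by
    simpa using ((tendsto_exp_neg_mul_sq ha).div_atTop
      (tendsto_id.const_mul_atTop (by positivity : 0 < 2 * a))).neg
  have hpos (x : ℝ) (hx : x ∈ Set.Ioi z) :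
      0 ≤ Real.exp (-a * x ^ 2) * (1 + 1 / (2 * a * x ^ 2)) := by positivity
  have hint := integrableOn_Ioi_deriv_of_nonneg' hderiv hpos htend
  have hval := integral_Ioi_of_hasDerivAt_of_nonneg' hderiv hpos htend
  rw [sub_neg_eq_add, zero_add] at hval
  rw [div_le_iff₀ (by positivity), ← hval, ← integral_mul_const]
  refine setIntegral_mono_on hint ((integrable_exp_neg_mul_sq ha).integrableOn.mul_const _)
    measurableSet_Ioi fun x hx => ?_
  have hx' : z < x := hx
  gcongr

lemma sum_exp_neg_mul_sq_mem_Icc {a z : ℝ} (ha : 0 < a) (hz : 0 ≤ z) :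
    ∑ n ∈ Finset.range (⌊z⌋₊ + 1), Real.exp (-a * (n : ℝ) ^ 2) ∈
      Set.Icc (∫ x in (0 : ℝ)..z, Real.exp (-a * x ^ 2))
        ((∫ x in (0 : ℝ)..z, Real.exp (-a * x ^ 2)) + 1) := by
  have hanti : AntitoneOn (fun x : ℝ => Real.exp (-a * x ^ 2)) (Set.Ici 0) := by
    intro x hx y hy hxy
    have : 0 ≤ x := hx
    refine Real.exp_le_exp.2 ?_
    nlinarith [mul_le_mul_of_nonneg_left (pow_le_pow_left₀ this hxy 2) ha.le]
  have hmono {y y' : ℝ} (hy : 0 ≤ y) (hyy : y ≤ y') :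
      ∫ x in (0 : ℝ)..y, Real.exp (-a * x ^ 2) ≤ ∫ x in (0 : ℝ)..y', Real.exp (-a * x ^ 2) :=
    intervalIntegral.integral_mono_interval le_rfl hy hyy (ae_of_all _ fun x => (Real.exp_pos _).le)
      (Continuous.intervalIntegrable (by fun_prop) _ _)
  constructor
  · have h := AntitoneOn.integral_le_sum (x₀ := 0) (a := ⌊z⌋₊ + 1)
      (hanti.mono fun x hx => hx.1)
    simp only [zero_add] at h
    refine (hmono hz ?_).trans h
    exact_mod_cast (Nat.lt_floor_add_one z).le
  · have h := AntitoneOn.sum_le_integral (x₀ := 0) (a := ⌊z⌋₊) (hanti.mono fun x hx => hx.1)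
    simp only [zero_add] at h
    rw [Finset.sum_range_succ']
    have := hmono (Nat.cast_nonneg _) (Nat.floor_le hz)
    simp only [Nat.cast_zero, ne_eq, OfNat.ofNat_ne_zero, not_false_eq_true, zero_pow, mul_zero,
      Real.exp_zero]
    linarith

lemma integral_zero_add_integral_Ioi_exp_neg_mul_sq {a z : ℝ} (ha : 0 < a) :
    (∫ x in (0 : ℝ)..z, Real.exp (-a * x ^ 2)) + ∫ x in Set.Ioi z, Real.exp (-a * x ^ 2) =
      √(Real.pi / a) / 2 := by
  rw [← integral_gaussian_Ioi]
  exact intervalIntegral.integral_interval_add_Ioi (integrable_exp_neg_mul_sq ha).integrableOn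
    (integrable_exp_neg_mul_sq ha).integrableOn

section

variable {p : ℤ → ℝ}

lemma summable_ite_ctPMF (hp0 : ∀ i, 0 ≤ p i) (hp : HasSum p 1) {t : ℝ} (ht : 0 ≤ t) (z : ℝ) :
    Summable fun x : ℤ => if z < (x : ℝ) then ctPMF p t x else 0 := by
  refine Summable.of_nonneg_of_le (fun x => ?_) (fun x => ?_) (hasSum_ctPMF hp0 hp ht).summable
  · split_ifs
    exacts [ctPMF_nonneg hp0 ht x, le_rfl]
  · split_ifs
    exacts [le_rfl, ctPMF_nonneg hp0 ht x]

lemma ctTailGt_antitone (hp0 : ∀ i, 0 ≤ p i) (hp : HasSum p 1) {t : ℝ} (ht : 0 ≤ t) :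
    Antitone (ctTailGt p t) := by
  intro z w hzw
  refine Summable.tsum_le_tsum (fun x => ?_) (summable_ite_ctPMF hp0 hp ht w)
    (summable_ite_ctPMF hp0 hp ht z)
  have := ctPMF_nonneg hp0 ht x
  split_ifs with h1 h2
  exacts [le_rfl, absurd (hzw.trans_lt h1) h2, this, le_rfl]

lemma two_mul_ctTailGt_add (hp0 : ∀ i, 0 ≤ p i) (hsym : ∀ i, p (-i) = p i) (hp : HasSum p 1)
    {t z : ℝ} (ht : 0 ≤ t) (hz : 0 ≤ z) :
    2 * ctTailGt p t z + 2 * ∑ n ∈ Finset.range (⌊z⌋₊ + 1), ctPMF p t n = 1 + ctPMF p t 0 := by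
  have h1 := (hasSum_ctPMF hp0 hp ht).nat_add_neg
  simp only [ctPMF_neg hp0 hsym hp ht, ← two_mul] at h1
  have h2 := (summable_ite_ctPMF hp0 hp ht z).hasSum.nat_add_neg
  have hneg (n : ℕ) : ¬ z < ((-(n : ℤ) : ℤ) : ℝ) := by
    push_cast
    have : (0 : ℝ) ≤ n := n.cast_nonneg
    linarith
  have h0 : ¬ z < ((0 : ℤ) : ℝ) := by simpa using hz
  simp only [hneg, h0, if_false, add_zero] at h2
  have h3 := (h2.mul_left 2).add (hasSum_sum_of_ne_finset_zero
    (f := fun n : ℕ => if n < ⌊z⌋₊ + 1 then 2 * ctPMF p t n else 0)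
    (s := Finset.range (⌊z⌋₊ + 1)) fun n hn => by simp_all)
  have h4 : HasSum (fun n : ℕ => 2 * ctPMF p t n) _ := h3.congr_fun fun n => ?_
  · rw [h1.unique h4, Finset.sum_congr rfl fun n hn => if_pos (Finset.mem_range.1 hn),
      Finset.mul_sum]
    rfl
  · have : n < ⌊z⌋₊ + 1 ↔ ¬ z < ((n : ℤ) : ℝ) := by
      rw [Nat.lt_add_one_iff, Nat.le_floor_iff hz, not_lt, Int.cast_natCast]
    simp only [this]
    split_ifs <;> ring

/-- A Berry–Esseen type estimate, combined with the Mills bounds for the Gaussian tail. -/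
lemma exists_ctTailGt_mem_Icc (hp0 : ∀ i, 0 ≤ p i) (hsym : ∀ i, p (-i) = p i) (hp : HasSum p 1)
    (hirr : ∀ x : ℤ, ∃ n : ℕ, 0 < convPow p n x)
    (h4 : Summable fun i : ℤ => (i : ℝ) ^ 4 * p i)
    {σ : ℝ} (hσ : 0 < σ) (hσ2 : σ ^ 2 = ∑' i : ℤ, (i : ℝ) ^ 2 * p i) :
    ∃ C > 0, ∀ t : ℝ, 1 ≤ t → ∀ u : ℝ, 0 < u →
      ctTailGt p t (σ * √t * u) ∈ Set.Icc
        (Real.exp (-(u ^ 2 / 2)) / (√(2 * Real.pi) * u) / (1 + 1 / u ^ 2) - C * (1 + u) / √t)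
        (Real.exp (-(u ^ 2 / 2)) / (√(2 * Real.pi) * u) + C * (1 + u) / √t) := by
  obtain ⟨C, hC, hlclt⟩ := exists_abs_ctPMF_sub_le hp0 hsym hp hirr h4 hσ hσ2
  have hpi := Real.pi_pos
  refine ⟨2 / (σ * √(2 * Real.pi)) + C * (2 + σ), by positivity, fun t ht u hu => ?_⟩
  have ht0 : 0 < t := by linarith
  have hst : 0 < √t := Real.sqrt_pos.2 ht0
  have hstt : √t * √t = t := Real.mul_self_sqrt ht0.le
  have hst1 : 1 ≤ √t := Real.one_le_sqrt.2 ht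
  set z := σ * √t * u with hz_def
  have hz : 0 < z := by positivity
  set a := (2 * σ ^ 2 * t)⁻¹ with ha_def
  have ha : 0 < a := by positivity
  set A := √(a / Real.pi) with hA_def
  have hA : A = 1 / (σ * √(2 * Real.pi) * √t) := by
    rw [hA_def, Real.sqrt_eq_iff_mul_self_eq_of_pos (by positivity)]
    rw [div_mul_div_comm, mul_mul_mul_comm, hstt, mul_mul_mul_comm,
      Real.mul_self_sqrt (by positivity), ha_def]
    field_simp
  have hApos : 0 < A := by positivity
  have hε (k : ℤ) : |ctPMF p t k - A * Real.exp (-a * (k : ℝ) ^ 2)| ≤ C / (t * √t) := by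
    simpa only [neg_mul] using hlclt t ht k
  set ε := C / (t * √t) with hε_def
  have hau : a * z ^ 2 = u ^ 2 / 2 := by
    rw [ha_def, hz_def, mul_pow, mul_pow, Real.sq_sqrt ht0.le]; field_simp
  have hAz : A / (2 * a * z) = 1 / (√(2 * Real.pi) * u) := by
    rw [hA, ha_def, hz_def]
    field_simp
    rw [Real.sq_sqrt ht0.le]
  have hAQ : A * (√(Real.pi / a) / 2) = 1 / 2 := by
    rw [hA_def, ← mul_div_assoc, ← Real.sqrt_mul (by positivity), div_mul_div_cancel₀ hpi.ne',
      div_self ha.ne', Real.sqrt_one]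
  have hup := mul_le_mul_of_nonneg_left (integral_Ioi_exp_neg_mul_sq_le ha hz) hApos.le
  have hlo := mul_le_mul_of_nonneg_left (le_integral_Ioi_exp_neg_mul_sq ha hz) hApos.le
  rw [mul_div_left_comm, hAz, neg_mul, hau, mul_one_div] at hup
  rw [← mul_div_assoc, mul_div_left_comm, hAz, neg_mul, hau, mul_one_div, mul_assoc 2, hau,
    mul_div_cancel₀ _ (two_ne_zero)] at hlo
  have hsplit := integral_zero_add_integral_Ioi_exp_neg_mul_sq (z := z) ha
  have hriem := sum_exp_neg_mul_sq_mem_Icc ha hz.le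
  have htail := two_mul_ctTailGt_add hp0 hsym hp ht0.le hz.le
  have hsum : |∑ n ∈ Finset.range (⌊z⌋₊ + 1), ctPMF p t n -
      A * ∑ n ∈ Finset.range (⌊z⌋₊ + 1), Real.exp (-a * (n : ℝ) ^ 2)| ≤ (z + 1) * ε := by
    rw [Finset.mul_sum, ← Finset.sum_sub_distrib]
    refine (Finset.abs_sum_le_sum_abs _ _).trans
      ((Finset.sum_le_card_nsmul _ _ ε fun n _ => by simpa using hε n).trans ?_)
    rw [Finset.card_range, nsmul_eq_mul]
    push_cast
    gcongr
    exact Nat.floor_le hz.le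
  have hP0 := hε 0
  simp only [Int.cast_zero, ne_eq, OfNat.ofNat_ne_zero, not_false_eq_true, zero_pow, mul_zero,
    Real.exp_zero, mul_one] at hP0
  have hP0' := ctPMF_nonneg hp0 ht0.le 0
  have herr : 2 * A + (z + 2) * ε ≤
      (2 / (σ * √(2 * Real.pi)) + C * (2 + σ)) * (1 + u) / √t := by
    have e1 : 2 * A ≤ 2 / (σ * √(2 * Real.pi)) * (1 + u) / √t := by
      rw [hA]
      calc _ = 2 / (σ * √(2 * Real.pi)) * 1 / √t := by field_simp
        _ ≤ _ := by gcongr; linarith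
    have e2 : z * ε ≤ C * σ * u / √t := by
      have : z * ε = C * σ * u / t := by rw [hz_def, hε_def]; field_simp
      rw [this]
      gcongr
      nlinarith
    have e3 : 2 * ε ≤ C * 2 / √t := by
      rw [hε_def, mul_comm C 2, mul_div_assoc]
      gcongr
      nlinarith
    have e4 : 0 ≤ C * 2 * u / √t + C * σ / √t := by positivity
    have e5 : (2 / (σ * √(2 * Real.pi)) + C * (2 + σ)) * (1 + u) / √t =
      2 / (σ * √(2 * Real.pi)) * (1 + u) / √t + C * σ * u / √t + C * 2 / √t +
        (C * 2 * u / √t + C * σ / √t) := by ring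
    rw [e5]
    linarith
  set S := ∑ n ∈ Finset.range (⌊z⌋₊ + 1), Real.exp (-a * (n : ℝ) ^ 2)
  set I := ∫ x in (0 : ℝ)..z, Real.exp (-a * x ^ 2)
  have hAI : A * I + A * (∫ x in Set.Ioi z, Real.exp (-a * x ^ 2)) = 1 / 2 := by
    rw [← mul_add, hsplit, hAQ]
  have h1 := mul_le_mul_of_nonneg_left hriem.1 hApos.le
  have h2 := mul_le_mul_of_nonneg_left hriem.2 hApos.le
  rw [mul_add, mul_one] at h2
  rw [abs_le] at hsum hP0
  have hεpos : 0 < ε := by positivity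
  constructor <;> linarith

end

/-- The Gaussian level at which the tail, multiplied by `exp (ℓ / 2)`, is close to `exp (-y)`. -/
lemma tendsto_gaussian_tail_level {α : Type*} {f : Filter α} {ℓ y : α → ℝ} {x : ℝ}
    (hℓ : Tendsto ℓ f atTop) (hy : Tendsto y f (𝓝 x)) :
    Tendsto (fun s => (y s + (ℓ s - Real.log (2 * Real.pi * ℓ s) / 2)) / √(ℓ s) / √(ℓ s)) f (𝓝 1) ∧
    Tendsto (fun s => (y s + (ℓ s - Real.log (2 * Real.pi * ℓ s) / 2)) / √(ℓ s)) f atTop ∧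
    Tendsto (fun s => Real.exp (ℓ s / 2) *
      (Real.exp (-(((y s + (ℓ s - Real.log (2 * Real.pi * ℓ s) / 2)) / √(ℓ s)) ^ 2 / 2)) /
        (√(2 * Real.pi) * ((y s + (ℓ s - Real.log (2 * Real.pi * ℓ s) / 2)) / √(ℓ s)))))
      f (𝓝 (Real.exp (-x))) := by
  have hpi := Real.pi_pos
  have hsqrt : Tendsto (fun s => √(ℓ s)) f atTop := Real.tendsto_sqrt_atTop.comp hℓ
  have hpos := hℓ.eventually_gt_atTop 0
  have hlog : Tendsto (fun s => Real.log (2 * Real.pi * ℓ s) / 2 / √(ℓ s)) f (𝓝 0) := by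
    have h1 : Tendsto (fun r : ℝ => Real.log r / √r) atTop (𝓝 0) := by
      simpa [Real.sqrt_eq_rpow] using
        (isLittleO_log_rpow_atTop (r := 1 / 2) (by norm_num)).tendsto_div_nhds_zero
    have h2 := (h1.comp (hℓ.const_mul_atTop (by positivity : 0 < 2 * Real.pi))).mul_const
      (√(2 * Real.pi) / 2)
    rw [zero_mul] at h2
    refine h2.congr' ?_
    filter_upwards [hpos] with s hs
    simp only [Function.comp]
    rw [Real.sqrt_mul (by positivity)]
    have := Real.sqrt_pos.2 hs
    field_simp
  have hw : Tendsto (fun s => (y s - Real.log (2 * Real.pi * ℓ s) / 2) / √(ℓ s)) f (𝓝 0) := by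
    simpa [sub_div] using (hy.div_atTop hsqrt).sub hlog
  have hu (s : α) (hs : 0 < ℓ s) : (y s + (ℓ s - Real.log (2 * Real.pi * ℓ s) / 2)) / √(ℓ s) =
      √(ℓ s) + (y s - Real.log (2 * Real.pi * ℓ s) / 2) / √(ℓ s) := by
    have := Real.sqrt_pos.2 hs
    field_simp
    rw [Real.sq_sqrt hs.le]
    ring
  have hratio : Tendsto
      (fun s => (y s + (ℓ s - Real.log (2 * Real.pi * ℓ s) / 2)) / √(ℓ s) / √(ℓ s)) f (𝓝 1) := by
    have h1 := (hw.div_atTop hsqrt).const_add 1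
    rw [add_zero] at h1
    refine h1.congr' ?_
    filter_upwards [hpos] with s hs
    have := Real.sqrt_pos.2 hs
    rw [hu s hs, add_div √(ℓ s), div_self this.ne']
  have hutop : Tendsto
      (fun s => (y s + (ℓ s - Real.log (2 * Real.pi * ℓ s) / 2)) / √(ℓ s)) f atTop := by
    have hw' : ∀ᶠ s in f, -1 ≤ (y s - Real.log (2 * Real.pi * ℓ s) / 2) / √(ℓ s) :=
      (hw.eventually_const_lt (by norm_num : (-1 : ℝ) < 0)).mono fun _ h => h.le
    refine (tendsto_atTop_add_right_of_le' f (-1) hsqrt hw').congr' ?_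
    filter_upwards [hpos] with s hs
    exact (hu s hs).symm
  refine ⟨hratio, hutop, ?_⟩
  have hlim := ((Real.continuous_exp.tendsto _).comp hy.neg).mul
    (((Real.continuous_exp.tendsto _).comp (((hw.pow 2).div_const 2).neg)).mul
      (hratio.inv₀ one_ne_zero))
  norm_num at hlim
  refine hlim.congr' ?_
  filter_upwards [hpos, hutop.eventually_gt_atTop 0] with s hs hus
  have hsq := Real.sqrt_pos.2 hs
  have hsplit : Real.exp (ℓ s / 2) *
      Real.exp (-(((y s + (ℓ s - Real.log (2 * Real.pi * ℓ s) / 2)) / √(ℓ s)) ^ 2 / 2)) =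
      Real.exp (-y s) * Real.exp (-(((y s - Real.log (2 * Real.pi * ℓ s) / 2) / √(ℓ s)) ^ 2 / 2)) *
        (√(2 * Real.pi) * √(ℓ s)) := by
    have hlogexp : √(2 * Real.pi) * √(ℓ s) = Real.exp (Real.log (2 * Real.pi * ℓ s) / 2) := by
      rw [← Real.sqrt_mul (by positivity), ← Real.log_sqrt (by positivity),
        Real.exp_log (by positivity)]
    rw [hlogexp, ← Real.exp_add, ← Real.exp_add, ← Real.exp_add, hu s hs, add_sq,
      Real.sq_sqrt hs.le]
    congr 1
    field_simp
    ring
  set u := (y s + (ℓ s - Real.log (2 * Real.pi * ℓ s) / 2)) / √(ℓ s)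
  rw [← mul_div_assoc (Real.exp (ℓ s / 2)), hsplit]
  field_simp

section

variable {p : ℤ → ℝ}

lemma tendsto_mul_ctTailGt (hp0 : ∀ i, 0 ≤ p i) (hsym : ∀ i, p (-i) = p i) (hp : HasSum p 1)
    (hirr : ∀ x : ℤ, ∃ n : ℕ, 0 < convPow p n x)
    (h4 : Summable fun i : ℤ => (i : ℝ) ^ 4 * p i)
    {σ : ℝ} (hσ : 0 < σ) (hσ2 : σ ^ 2 = ∑' i : ℤ, (i : ℝ) ^ 2 * p i) {Λ y : ℝ → ℝ} {x : ℝ}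
    (hΛ : Tendsto Λ atTop atTop)
    (hΛ' : Tendsto (fun t => Λ t * √(Real.log (Λ t ^ 2)) / √t) atTop (𝓝 0))
    (hy : Tendsto y atTop (𝓝 x)) :
    Tendsto (fun t => Λ t * ctTailGt p t (σ * √(t / Real.log (Λ t ^ 2)) *
        (y t + Real.log (Λ t ^ 2 / √(2 * Real.pi * Real.log (Λ t ^ 2))))))
      atTop (𝓝 (Real.exp (-x))) := by
  obtain ⟨C, hC, hbound⟩ := exists_ctTailGt_mem_Icc hp0 hsym hp hirr h4 hσ hσ2
  have hpi := Real.pi_pos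
  have hℓ : Tendsto (fun t => Real.log (Λ t ^ 2)) atTop atTop :=
    Real.tendsto_log_atTop.comp ((tendsto_pow_atTop two_ne_zero).comp hΛ)
  obtain ⟨hratio, hutop, hmain⟩ := tendsto_gaussian_tail_level hℓ hy
  set u : ℝ → ℝ := fun t => (y t + (Real.log (Λ t ^ 2) -
    Real.log (2 * Real.pi * Real.log (Λ t ^ 2)) / 2)) / √(Real.log (Λ t ^ 2)) with hu
  have hinv : Tendsto (fun t => (√(Real.log (Λ t ^ 2)))⁻¹) atTop (𝓝 0) :=
    (Real.tendsto_sqrt_atTop.comp hℓ).inv_tendsto_atTop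
  have herr : Tendsto (fun t => Λ t * (C * (1 + u t) / √t)) atTop (𝓝 0) := by
    have h := (hΛ'.mul (hinv.add hratio)).const_mul C
    rw [zero_mul, mul_zero] at h
    refine h.congr' ?_
    filter_upwards [hℓ.eventually_gt_atTop 0, eventually_gt_atTop 0] with t h1 h2
    have := Real.sqrt_pos.2 h1
    have := Real.sqrt_pos.2 h2
    change C * (_ * (_ + u t / _)) = _
    field_simp
  have hmain' : Tendsto (fun t => Λ t * (Real.exp (-(u t ^ 2 / 2)) / (√(2 * Real.pi) * u t)))
      atTop (𝓝 (Real.exp (-x))) := by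
    refine hmain.congr' ?_
    filter_upwards [hΛ.eventually_gt_atTop 0] with t h1
    rw [Real.log_pow, Nat.cast_ofNat, mul_div_cancel_left₀ _ two_ne_zero, Real.exp_log h1]
    simp only [hu, Real.log_pow, Nat.cast_ofNat]
  have hmills : Tendsto (fun t => 1 + 1 / u t ^ 2) atTop (𝓝 1) := by
    have h := (((tendsto_pow_atTop two_ne_zero).comp hutop).inv_tendsto_atTop).const_add (1 : ℝ)
    simpa using h
  have hlo := (hmain'.div hmills one_ne_zero).sub herr
  have hup := hmain'.add herr
  rw [div_one, sub_zero] at hlo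
  rw [add_zero] at hup
  have harg : ∀ᶠ t in atTop, σ * √(t / Real.log (Λ t ^ 2)) *
      (y t + Real.log (Λ t ^ 2 / √(2 * Real.pi * Real.log (Λ t ^ 2)))) = σ * √t * u t := by
    filter_upwards [hℓ.eventually_gt_atTop 0, eventually_gt_atTop 0, hΛ.eventually_gt_atTop 0]
      with t h1 h2 h3
    rw [Real.sqrt_div h2.le, Real.log_div (by positivity) (by positivity),
      Real.log_sqrt (by positivity), hu]
    ring
  refine tendsto_of_tendsto_of_tendsto_of_le_of_le' hlo hup ?_ ?_
  all_goals
    filter_upwards [harg, eventually_ge_atTop 1, hutop.eventually_gt_atTop 0,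
      hΛ.eventually_gt_atTop 0] with t h1 h2 h3 h4
    rw [h1]
    have hb := hbound t h2 (u t) h3
  · simp only [Pi.div_apply]
    rw [mul_div_assoc, ← mul_sub]
    exact mul_le_mul_of_nonneg_left hb.1 h4.le
  · rw [← mul_add]
    exact mul_le_mul_of_nonneg_left hb.2 h4.le

lemma sum_shifted_ctTailGt_mem_Icc (hp0 : ∀ i, 0 ≤ p i) (hp : HasSum p 1) {t : ℝ} (ht : 0 ≤ t)
    (N : ℕ) (z : ℝ) :
    (∑' i : ℤ, if -(N : ℤ) ≤ i ∧ i ≤ 0 then ctTailGt p t (z - (i : ℝ)) else 0) ∈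
      Set.Icc ((N + 1) * ctTailGt p t (z + N)) ((N + 1) * ctTailGt p t z) := by
  have hanti := ctTailGt_antitone hp0 hp ht
  have hcard : (Finset.Icc (-(N : ℤ)) 0).card = N + 1 := by simp; omega
  rw [tsum_eq_sum (s := Finset.Icc (-(N : ℤ)) 0) fun i hi => if_neg (by simpa using hi),
    Finset.sum_congr rfl fun i hi => if_pos (Finset.mem_Icc.1 hi)]
  constructor
  · have h := Finset.card_nsmul_le_sum (Finset.Icc (-(N : ℤ)) 0)
      (fun i : ℤ => ctTailGt p t (z - (i : ℝ))) (ctTailGt p t (z + N)) fun i hi => hanti ?_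
    · rw [hcard, nsmul_eq_mul] at h
      exact_mod_cast h
    · have : -(N : ℝ) ≤ i := by exact_mod_cast (Finset.mem_Icc.1 hi).1
      linarith
  · have h := Finset.sum_le_card_nsmul (Finset.Icc (-(N : ℤ)) 0)
      (fun i : ℤ => ctTailGt p t (z - (i : ℝ))) (ctTailGt p t z) fun i hi => hanti ?_
    · rw [hcard, nsmul_eq_mul] at h
      exact_mod_cast h
    · have : (i : ℝ) ≤ 0 := by exact_mod_cast (Finset.mem_Icc.1 hi).2
      linarith

end

lemma tendsto_mul_sqrt_log_sq_div_sqrt {Λ : ℝ → ℝ} (hΛ : Tendsto Λ atTop atTop)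
    (hΛ' : Tendsto (fun t => Λ t * √(Real.log t / t)) atTop (𝓝 0)) :
    Tendsto (fun t => Λ t * √(Real.log (Λ t ^ 2)) / √t) atTop (𝓝 0) := by
  refine tendsto_of_tendsto_of_tendsto_of_le_of_le' tendsto_const_nhds hΛ' ?_ ?_
  · filter_upwards [hΛ.eventually_ge_atTop 0] with t h
    positivity
  · filter_upwards [hΛ.eventually_gt_atTop 0, hΛ'.eventually_lt_const one_pos,
      Real.tendsto_log_atTop.eventually_ge_atTop 1, eventually_gt_atTop 0] with t h1 h2 h3 h4
    have hst := Real.sqrt_pos.2 h4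
    have hsl : 1 ≤ √(Real.log t) := Real.one_le_sqrt.2 h3
    rw [Real.sqrt_div (by linarith)] at h2 ⊢
    rw [mul_div_assoc]
    have hle : Λ t ^ 2 ≤ t := by
      rw [← mul_div_assoc, div_lt_one hst] at h2
      have hlt : Λ t ≤ √t := by nlinarith
      exact (pow_le_pow_left₀ h1.le hlt 2).trans_eq (Real.sq_sqrt h4.le)
    gcongr

/-- Mean convergence in the slow `L`-step regime: with `L → ∞`,
`L = o(√(t/log t))`, and `z = σ b_t^{(L)} (x + a_t^{(L)})` where
`a_t^{(L)} = log(L²/√(2π log L²))`, `b_t^{(L)} = √(t/log L²)`, one has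
`E_{η_L}[N_t] = ∑_{i=-L}^0 P_i(ξ_t > z) → e^{-x}`. -/
theorem stmt19 (p : ℤ → ℝ) (hp0 : ∀ i, 0 ≤ p i) (hsym : ∀ i, p (-i) = p i)
    (hsum : ∑' i : ℤ, p i = 1)
    (hirr : ∀ x : ℤ, ∃ n : ℕ, 0 < convPow p n x)
    (θ : ℝ) (hθ : 0 < θ)
    (hexp : Summable fun i : ℤ => Real.exp (θ * (i : ℝ)) * p i)
    (σ : ℝ) (hσ : 0 < σ) (hσ2 : σ ^ 2 = ∑' i : ℤ, (i : ℝ) ^ 2 * p i)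
    (L : ℝ → ℕ)
    (hL1 : Tendsto (fun t : ℝ => (L t : ℝ)) atTop atTop)
    (hL2 : Tendsto (fun t : ℝ => (L t : ℝ) * Real.sqrt (Real.log t / t)) atTop (𝓝 0))
    (x : ℝ) :
    Tendsto (fun t : ℝ =>
        ∑' i : ℤ, if -(L t : ℤ) ≤ i ∧ i ≤ 0 then
          ctTailGt p t
            (σ * Real.sqrt (t / Real.log ((L t : ℝ) ^ 2))
              * (x + Real.log ((L t : ℝ) ^ 2
                  / Real.sqrt (2 * Real.pi * Real.log ((L t : ℝ) ^ 2)))) - (i : ℝ))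
        else 0)
      atTop (𝓝 (Real.exp (-x))) := by
  have hp : HasSum p 1 := by
    have : Summable p := by
      by_contra h
      rw [tsum_eq_zero_of_not_summable h] at hsum
      exact zero_ne_one hsum
    exact hsum ▸ this.hasSum
  have h4 := summable_pow_four_mul hp0 hsym hθ hexp
  have hΛ' := tendsto_mul_sqrt_log_sq_div_sqrt hL1 hL2
  have hshift : Tendsto (fun t => x + (L t : ℝ) * √(Real.log ((L t : ℝ) ^ 2)) / √t / σ) atTop
      (𝓝 x) := by
    simpa using (hΛ'.div_const σ).const_add x
  have hup := tendsto_mul_ctTailGt hp0 hsym hp hirr h4 hσ hσ2 hL1 hΛ' (tendsto_const_nhds (x := x))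
  have hlo := tendsto_mul_ctTailGt hp0 hsym hp hirr h4 hσ hσ2 hL1 hΛ' hshift
  have hfac : Tendsto (fun t => 1 + (L t : ℝ)⁻¹) atTop (𝓝 1) := by
    simpa using hL1.inv_tendsto_atTop.const_add (1 : ℝ)
  have hup' := hfac.mul hup
  have hlo' := hfac.mul hlo
  rw [one_mul] at hup' hlo'
  have hℓ : Tendsto (fun t => Real.log ((L t : ℝ) ^ 2)) atTop atTop :=
    Real.tendsto_log_atTop.comp ((tendsto_pow_atTop two_ne_zero).comp hL1)
  refine tendsto_of_tendsto_of_tendsto_of_le_of_le' hlo' hup' ?_ ?_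
  · filter_upwards [hL1.eventually_gt_atTop 0, eventually_gt_atTop 0, hℓ.eventually_gt_atTop 0]
      with t h1 h2 h3
    refine le_trans (le_of_eq ?_) (sum_shifted_ctTailGt_mem_Icc hp0 hp h2.le (L t) _).1
    have hst := Real.sqrt_pos.2 h2
    have hsl := Real.sqrt_pos.2 h3
    rw [← mul_assoc, add_mul 1, inv_mul_cancel₀ h1.ne', one_mul, Real.sqrt_div h2.le]
    congr 2
    field_simp
    ring
  · filter_upwards [hL1.eventually_gt_atTop 0, eventually_gt_atTop 0] with t h1 h2
    refine (sum_shifted_ctTailGt_mem_Icc hp0 hp h2.le (L t) _).2.trans (le_of_eq ?_)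
    rw [← mul_assoc, add_mul 1, inv_mul_cancel₀ h1.ne', one_mul]
end
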